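/- arXiv:0907.3387 — 12 statements merged into one kernel-verified Lean document; each statement's English description precedes it below -/
import Mathlib

section
/- Let n and d be positive integers and let C = {f ∈ S_n : f(i) ≡ i (mod d) for all i ∈ [n]}. Then C is a subgroup of S_n, any two distinct elements f, g ∈ C satisfy d∞(f,g) ≥ d, and |C| = (⌈n/d⌉!)^(n mod d) · (⌊n/d⌋!)^(d − (n mod d)). -/
/-- The ℓ∞-distance between two permutations of `Fin n`:
`d∞(f,g) = max_i |f(i) - g(i)|`. -/
def dinf {n : ℕ} (f g : Equiv.Perm (Fin n)) : ℕ :=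
  Finset.univ.sup fun i => (((f i : ℕ) : ℤ) - ((g i : ℕ) : ℤ)).natAbs

/-- Construction 1: for positive integers `n, d`, the set
`C = {f ∈ S_n : f(i) ≡ i (mod d) for all i}` is a subgroup of `S_n`, any two
distinct elements of `C` are at ℓ∞-distance at least `d`, and
`|C| = (⌈n/d⌉!)^(n mod d) ⬝ (⌊n/d⌋!)^(d - n mod d)`. -/
theorem construction_simple (n d : ℕ) (hn : 0 < n) (hd : 0 < d) :
    (∃ H : Subgroup (Equiv.Perm (Fin n)),
      (H : Set (Equiv.Perm (Fin n))) =
        {f : Equiv.Perm (Fin n) | ∀ i : Fin n, (f i : ℕ) % d = (i : ℕ) % d}) ∧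
    (∀ f ∈ {f : Equiv.Perm (Fin n) | ∀ i : Fin n, (f i : ℕ) % d = (i : ℕ) % d},
      ∀ g ∈ {f : Equiv.Perm (Fin n) | ∀ i : Fin n, (f i : ℕ) % d = (i : ℕ) % d},
        f ≠ g → d ≤ dinf f g) ∧
    Nat.card {f : Equiv.Perm (Fin n) | ∀ i : Fin n, (f i : ℕ) % d = (i : ℕ) % d} =
      (Nat.factorial ((n + d - 1) / d)) ^ (n % d) *
        (Nat.factorial (n / d)) ^ (d - n % d) := by
  refine ⟨?_, ?_, ?_⟩
  · refine ⟨{ carrier := {f | ∀ i : Fin n, (f i : ℕ) % d = (i : ℕ) % d}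
              mul_mem' := ?_, one_mem' := ?_, inv_mem' := ?_ }, rfl⟩
    · intro f g hf hg i
      rw [Equiv.Perm.mul_apply]
      exact (hf (g i)).trans (hg i)
    · intro i
      rfl
    · intro f hf i
      have h := hf (f⁻¹ i)
      rw [show f (f⁻¹ i) = i from f.apply_symm_apply i] at h
      exact h.symm
  · intro f hf g hg hne
    obtain ⟨i, hi⟩ : ∃ i, f i ≠ g i := by
      by_contra! h
      exact hne (Equiv.ext h)
    have hle : (((f i : ℕ) : ℤ) - ((g i : ℕ) : ℤ)).natAbs ≤ dinf f g :=
      Finset.le_sup (f := fun i => (((f i : ℕ) : ℤ) - ((g i : ℕ) : ℤ)).natAbs)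
        (Finset.mem_univ i)
    refine le_trans ?_ hle
    have hmod : (g i : ℕ) ≡ (f i : ℕ) [MOD d] := (hg i).trans (hf i).symm
    have hdvd : (d : ℤ) ∣ ((f i : ℕ) : ℤ) - ((g i : ℕ) : ℤ) := hmod.dvd
    have hne' : ((f i : ℕ) : ℤ) - ((g i : ℕ) : ℤ) ≠ 0 := by
      intro h
      apply hi
      apply Fin.ext
      omega
    exact Nat.le_of_dvd (Int.natAbs_pos.mpr hne') (Int.natCast_dvd.mp hdvd)
  · let p : Fin n → Fin d := fun i => ⟨(i : ℕ) % d, Nat.mod_lt _ hd⟩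
    have hset : {f : Equiv.Perm (Fin n) | ∀ i : Fin n, (f i : ℕ) % d = (i : ℕ) % d} =
        {g : Equiv.Perm (Fin n) | p ∘ g = p} := by
      ext f
      simp [p, funext_iff]
    have hcount : ∀ i : Fin d, Fintype.card {a // p a = i} =
        n / d + if (i : ℕ) < n % d then 1 else 0 := by
      intro i
      have h := Nat.count_modEq_card n hd (i : ℕ)
      rw [Nat.mod_eq_of_lt i.2] at h
      rw [← h, Nat.count_eq_card_filter_range, Fintype.card_subtype]
      refine Finset.card_bij (fun a _ => (a : ℕ)) ?_ ?_ ?_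
      · intro a ha
        simp only [p, Finset.mem_filter, Finset.mem_univ, true_and, Fin.ext_iff] at ha
        simp [Nat.ModEq, ha, Nat.mod_eq_of_lt i.2]
      · intro a _ b _ hab
        exact Fin.ext hab
      · intro b hb
        simp only [Finset.mem_filter, Finset.mem_range, Nat.ModEq, Nat.mod_eq_of_lt i.2] at hb
        exact ⟨⟨b, hb.1⟩, by simp [p, Fin.ext_iff, hb.2], rfl⟩
    have hcard : Nat.card {g : Equiv.Perm (Fin n) | p ∘ g = p} =
        ∏ i : Fin d, (Fintype.card {a // p a = i}).factorial := by
      rw [← DomMulAct.stabilizer_card p, ← Nat.card_eq_fintype_card]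
      rfl
    rw [hset, hcard, Finset.prod_congr rfl (fun i _ => by rw [hcount i]),
      Fin.prod_univ_eq_prod_range
        (fun i => (n / d + if i < n % d then 1 else 0).factorial) d,
      ← Finset.prod_range_mul_prod_Ico _ (Nat.mod_lt n hd).le]
    congr 1
    · rw [Finset.prod_congr rfl (g := fun _ => ((n + d - 1) / d).factorial)]
      · simp
      · intro i hi
        rw [Finset.mem_range] at hi
        rw [if_pos hi]
        congr 1
        have h1 := Nat.div_add_mod n d
        have h2 : n + d - 1 = (n % d - 1) + d * (n / d + 1) := by
          rw [mul_add]
          omega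
        have h3 := Nat.mod_lt n hd
        rw [h2, Nat.add_mul_div_left _ _ hd, Nat.div_eq_of_lt (show n % d - 1 < d by omega), zero_add]
    · rw [Finset.prod_congr rfl (g := fun _ => (n / d).factorial)]
      · simp
      · intro i hi
        rw [Finset.mem_Ico] at hi
        rw [if_neg (by omega), add_zero]
end

section
/- Let C ≤ S_n be a subgroup of S_n with d∞(f,g) ≥ d for all distinct f,g ∈ C, and |C| = M, where 1 ≤ d ≤ n. Then M · (d!)^⌊n/d⌋ · (n mod d)! ≤ n!. -/
theorem fiber_card_aux (n d q i m : ℕ) (hd : 1 ≤ d) (f : Fin n → Fin (q+1))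
    (hf : ∀ a, (f a : ℕ) = a / d) (j : Fin (q+1)) (hj : (j : ℕ) = i) (hm : m ≤ d)
    (hn : d * i + m ≤ n) : m ≤ Fintype.card {a // f a = j} := by
  have h := Fintype.card_le_of_injective
    (fun k : Fin m => (⟨⟨d * i + k, by omega⟩, by
      apply Fin.ext
      rw [hf, hj]
      simp only
      rw [Nat.mul_add_div (by omega), Nat.div_eq_of_lt (by omega), add_zero]⟩ :
        {a // f a = j})) (by
      intro a b hab
      simp only [Subtype.mk.injEq, Fin.mk.injEq] at hab
      exact Fin.ext (by omega))
  simpa using h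

/-- If `C ≤ S_n` is a subgroup with minimum ℓ∞-distance at least `d`, `1 ≤ d ≤ n`,
then `|C| ⬝ (d!)^⌊n/d⌋ ⬝ (n mod d)! ≤ n!`. -/
theorem subgroup_code_upper_bound (n d : ℕ) (hd : 1 ≤ d) (hdn : d ≤ n)
    (C : Subgroup (Equiv.Perm (Fin n)))
    (hC : ∀ f ∈ C, ∀ g ∈ C, f ≠ g → d ≤ dinf f g) :
    Nat.card C * (Nat.factorial d) ^ (n / d) * Nat.factorial (n % d) ≤
      Nat.factorial n := by
  classical
  let f : Fin n → Fin (n / d + 1) := fun a =>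
    ⟨a / d, Nat.lt_succ_of_le (Nat.div_le_div_right a.2.le)⟩
  have hf : ∀ a, (f a : ℕ) = a / d := fun _ => rfl
  have hY := DomMulAct.stabilizer_card f
  have hle : (Nat.factorial d) ^ (n / d) * Nat.factorial (n % d) ≤
      Fintype.card {g : Equiv.Perm (Fin n) // f ∘ g = f} := by
    rw [hY, Fin.prod_univ_castSucc]
    have hdm := Nat.div_add_mod n d
    apply Nat.mul_le_mul
    · rw [← Fin.prod_const]
      apply Finset.prod_le_prod' 
      intro i _
      apply Nat.factorial_le
      apply fiber_card_aux n d _ i d hd f hf _ (by simp) le_rfl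
      have : d * (i + 1) ≤ d * (n / d) := Nat.mul_le_mul_left _ i.2
      rw [mul_add] at this
      omega
    · apply Nat.factorial_le
      exact fiber_card_aux n d _ (n / d) (n % d) hd f hf _ (by simp)
        (Nat.mod_lt _ hd).le hdm.le
  have hinj : Function.Injective
      (fun p : C × {g : Equiv.Perm (Fin n) // f ∘ g = f} =>
        (p.2 : Equiv.Perm (Fin n)) * ((p.1 : Equiv.Perm (Fin n)))) := by
    rintro ⟨⟨c, hc⟩, ⟨y, hy⟩⟩ ⟨⟨c', hc'⟩, ⟨y', hy'⟩⟩ h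
    simp only at h
    have hcc : c = c' := by
      by_contra hne
      have h1 := hC c hc c' hc' hne
      have h2 : dinf c c' < d := by
        unfold dinf
        rw [Finset.sup_lt_iff (by simp only [Nat.bot_eq_zero]; omega)]
        intro i _
        have e1 : f (c i) = f (c' i) := by
          rw [← congrFun hy (c i), ← congrFun hy' (c' i)]
          exact congrArg f (congrArg (fun g : Equiv.Perm (Fin n) => g i) h)
        have e2 : ((c i : ℕ)) / d = (c' i : ℕ) / d := congrArg Fin.val e1
        have a1 := Nat.div_add_mod (c i : ℕ) d
        have a2 := Nat.div_add_mod (c' i : ℕ) d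
        rw [e2] at a1
        have b1 := Nat.mod_lt (c i : ℕ) hd
        have b2 := Nat.mod_lt (c' i : ℕ) hd
        omega
      omega
    subst hcc
    have := mul_right_cancel h
    subst this
    rfl
  have hcard := Nat.card_le_card_of_injective _ hinj
  rw [Nat.card_prod, Nat.card_perm, Nat.card_eq_fintype_card (α := Fin n), Fintype.card_fin,
    Nat.card_eq_fintype_card (α := {g : Equiv.Perm (Fin n) // f ∘ g = f})] at hcard
  rw [mul_assoc]
  exact (Nat.mul_le_mul_left _ hle).trans hcard
end

section
/- Let C ≤ S_n be a subgroup of S_n with d∞(f,g) ≥ d for all distinct f,g ∈ C, 1 ≤ d ≤ n, whose cardinality M attains the bound M · (d!)^⌊n/d⌋ · (n mod d)! = n!. Then C acts transitively on the d-element subsets of [n]: for any two subsets A, B ⊆ [n] with |A| = |B| = d there exists f ∈ C with f(A) = B (i.e., C is d-homogeneous). -/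
/-- The Young subgroup preserving the blocks of `d` consecutive points. -/
def blockSub (n d : ℕ) : Subgroup (Equiv.Perm (Fin n)) where
  carrier := {h | ∀ i, (h i : ℕ) / d = (i : ℕ) / d}
  mul_mem' := by
    intro a b ha hb i
    rw [Equiv.Perm.mul_apply, ha, hb]
  one_mem' := by intro i; rfl
  inv_mem' := by
    intro a ha i
    have := ha (a⁻¹ i)
    rw [← Equiv.Perm.mul_apply, mul_inv_cancel, Equiv.Perm.one_apply] at this
    exact this.symm

theorem card_block (n d : ℕ) (hd : 1 ≤ d) (q : ℕ) (hq : q < n / d) :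
    Fintype.card {a : Fin n // (a : ℕ) / d = q} = d := by
  have h1 : (q + 1) * d ≤ n := (Nat.le_div_iff_mul_le hd).1 hq
  have e : Fin d ≃ {a : Fin n // (a : ℕ) / d = q} :=
    { toFun := fun j => ⟨⟨q * d + j, by have := j.2; nlinarith⟩, by
        show (q * d + j) / d = q
        rw [mul_comm, Nat.mul_add_div hd, Nat.div_eq_of_lt j.2, add_zero]⟩
      invFun := fun a => ⟨(a.1 : ℕ) % d, Nat.mod_lt _ hd⟩
      left_inv := fun j => by
        ext; simp [Nat.mod_eq_of_lt j.2]
      right_inv := fun a => by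
        obtain ⟨a, ha⟩ := a
        ext; simp only [← ha]; exact Nat.div_add_mod' _ _ }
  rw [← Fintype.card_congr e, Fintype.card_fin]

theorem card_last (n d : ℕ) (hd : 1 ≤ d) :
    Fintype.card {a : Fin n // (a : ℕ) / d = n / d} = n % d := by
  have h1 := Nat.div_add_mod' n d
  have e : Fin (n % d) ≃ {a : Fin n // (a : ℕ) / d = n / d} :=
    { toFun := fun j => ⟨⟨n / d * d + j, by have := j.2; omega⟩, by
        have h3 : (j : ℕ) < d := j.2.trans (Nat.mod_lt _ hd)
        show (n / d * d + j) / d = n / d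
        rw [mul_comm, Nat.mul_add_div hd, Nat.div_eq_of_lt h3, add_zero]⟩
      invFun := fun a => ⟨(a.1 : ℕ) % d, by
        obtain ⟨a, ha⟩ := a
        have h2 := Nat.div_add_mod' (a : ℕ) d
        rw [ha] at h2
        have := a.2
        show (a : ℕ) % d < n % d
        omega⟩
      left_inv := fun j => by
        have h3 : (j : ℕ) < d := j.2.trans (Nat.mod_lt _ hd)
        ext; simp [Nat.mod_eq_of_lt h3]
      right_inv := fun a => by
        obtain ⟨a, ha⟩ := a
        ext; simp only [← ha]; exact Nat.div_add_mod' _ _ }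
  rw [← Fintype.card_congr e, Fintype.card_fin]

theorem card_blockSub (n d : ℕ) (hd : 1 ≤ d) :
    Nat.card (blockSub n d) = (Nat.factorial d) ^ (n / d) * Nat.factorial (n % d) := by
  classical
  let b : Fin n → Fin (n / d + 1) := fun i =>
    ⟨(i : ℕ) / d, Nat.lt_succ_of_le (Nat.div_le_div_right i.2.le)⟩
  have h := DomMulAct.stabilizer_card b
  rw [Fin.prod_univ_castSucc] at h
  have h1 : ∀ i : Fin (n / d), Fintype.card {a // b a = i.castSucc} = d := fun i => by
    refine Eq.trans ?_ (card_block n d hd i i.2)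
    exact Fintype.card_congr (Equiv.subtypeEquivRight fun a => by simp [b, Fin.ext_iff])
  have h2 : Fintype.card {a // b a = Fin.last (n / d)} = n % d := by
    rw [← card_last n d hd]
    exact Fintype.card_congr (Equiv.subtypeEquivRight fun a => by simp [b, Fin.ext_iff])
  simp only [h1, h2, Finset.prod_const, Finset.card_univ, Fintype.card_fin] at h
  rw [← h, ← Nat.card_eq_fintype_card]
  refine Nat.card_congr (Equiv.subtypeEquivRight fun g => ?_)
  simp only [funext_iff, b, Fin.ext_iff, Function.comp]
  rfl

theorem optimal_subgroup_code_homogeneous (n d : ℕ) (hd : 1 ≤ d) (hdn : d ≤ n)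
    (C : Subgroup (Equiv.Perm (Fin n)))
    (hC : ∀ f ∈ C, ∀ g ∈ C, f ≠ g → d ≤ dinf f g)
    (hopt : Nat.card C * (Nat.factorial d) ^ (n / d) * Nat.factorial (n % d) =
      Nat.factorial n) :
    ∀ A B : Finset (Fin n), A.card = d → B.card = d →
      ∃ f ∈ C, A.image (⇑f) = B := by
  classical
  have hdisj : Disjoint C (blockSub n d) := by
    rw [Subgroup.disjoint_def]
    intro f hf hb
    by_contra hne
    have h1 := hC f hf 1 C.one_mem hne
    have h2 : dinf f 1 < d := by
      unfold dinf
      rw [Finset.sup_lt_iff (by simp only [Nat.bot_eq_zero]; omega)]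
      intro i _
      have h3 : (f i : ℕ) / d = (i : ℕ) / d := hb i
      have h4 := Nat.div_add_mod' (f i : ℕ) d
      have h5 := Nat.div_add_mod' (i : ℕ) d
      have h6 := Nat.mod_lt (f i : ℕ) hd
      have h7 := Nat.mod_lt (i : ℕ) hd
      rw [h3] at h4
      rw [Equiv.Perm.one_apply]
      omega
    omega
  have hcomp : Subgroup.IsComplement' C (blockSub n d) := by
    refine Subgroup.isComplement'_of_card_mul_and_disjoint ?_ hdisj
    rw [card_blockSub n d hd, ← mul_assoc, hopt, Nat.card_eq_fintype_card, Fintype.card_perm,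
      Fintype.card_fin]
  let I : Finset (Fin n) := Finset.univ.filter fun i => (i : ℕ) / d = 0
  have hI : I.card = d := by
    rw [← Fintype.card_subtype]
    exact card_block n d hd 0 (Nat.div_pos hdn hd)
  have key : ∀ B : Finset (Fin n), B.card = d → ∃ f ∈ C, I.image (⇑f) = B := by
    intro B hB
    obtain ⟨σ, hσ⟩ : ∃ σ : Equiv.Perm (Fin n), I.image σ = B := by
      have e : {x // x ∈ I} ≃ {x // x ∈ B} := Finset.equivOfCardEq (hI.trans hB.symm)
      refine ⟨e.extendSubtype, ?_⟩
      apply Finset.eq_of_subset_of_card_le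
      · intro y hy
        obtain ⟨x, hx, rfl⟩ := Finset.mem_image.1 hy
        exact e.extendSubtype_mem x hx
      · rw [Finset.card_image_of_injective _ (Equiv.injective _), hI, hB]
    obtain ⟨⟨c, h⟩, hch⟩ := hcomp.2 σ
    refine ⟨c, c.2, ?_⟩
    have hhI : I.image (h : Equiv.Perm (Fin n)) = I := by
      apply Finset.eq_of_subset_of_card_le
      · intro y hy
        obtain ⟨x, hx, rfl⟩ := Finset.mem_image.1 hy
        have h3 : ((h : Equiv.Perm (Fin n)) x : ℕ) / d = (x : ℕ) / d := h.2 x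
        simp only [I, Finset.mem_filter, Finset.mem_univ, true_and] at hx ⊢
        rw [h3, hx]
      · rw [Finset.card_image_of_injective _ (Equiv.injective _)]
    have hch' : (c : Equiv.Perm (Fin n)) * h = σ := hch
    rw [← hσ, ← hch', Equiv.Perm.coe_mul, ← Finset.image_image, hhI]
  intro A B hA hB
  obtain ⟨f, hf, rfl⟩ := key A hA
  obtain ⟨g, hg, rfl⟩ := key B hB
  refine ⟨g * f⁻¹, C.mul_mem hg (C.inv_mem hf), ?_⟩
  rw [Finset.image_image, ← Equiv.Perm.coe_mul, inv_mul_cancel_right]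
end

section
/- Let C ≤ S_n be a subgroup of S_n with d∞(f,g) ≥ d for all distinct f,g ∈ C, 1 ≤ d ≤ n, whose cardinality M attains the bound M · (d!)^⌊n/d⌋ · (n mod d)! = n!. For positive integers m ≥ k, let K_{m,k} = lcm{ C(m,k), C(m,k−1), …, C(m,1) }, where C(m,j) denotes the binomial coefficient. Then lcm{ K_{n−i·d, d} : i ∈ ℤ, 0 ≤ i ≤ (n − 2d + 1)/d } divides M. -/
/-- `K_{m,k} = lcm{C(m,k), C(m,k-1), …, C(m,1)}`. -/
def Kconst (m k : ℕ) : ℕ :=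
  (Finset.Icc 1 k).lcm fun j => Nat.choose m j

open Finset in
theorem adj_aux {α : Type*} [DecidableEq α] (Ω : Finset α) (k : ℕ) (f g : Finset α → ℚ) :
    ∑ A ∈ Ω.powerset with A.card = k, f A * ∑ b ∈ A, g (A.erase b) =
    ∑ E ∈ Ω.powerset with E.card + 1 = k, g E * ∑ a ∈ Ω \ E, f (insert a E) := by
  simp_rw [Finset.mul_sum]
  rw [Finset.sum_sigma', Finset.sum_sigma']
  refine Finset.sum_bij' (fun x _ => ⟨x.1.erase x.2, x.2⟩) (fun x _ => ⟨insert x.2 x.1, x.2⟩)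
    ?_ ?_ ?_ ?_ ?_
  · rintro ⟨A, b⟩ h
    simp only [mem_sigma, mem_filter, mem_powerset, mem_sdiff] at h ⊢
    obtain ⟨⟨h1, h2⟩, h3⟩ := h
    refine ⟨⟨(erase_subset _ _).trans h1, ?_⟩, h1 h3, by simp⟩
    rw [card_erase_add_one h3, h2]
  · rintro ⟨A, b⟩ h
    simp only [mem_sigma, mem_filter, mem_powerset, mem_sdiff] at h ⊢
    obtain ⟨⟨h1, h2⟩, h3, h4⟩ := h
    refine ⟨⟨insert_subset h3 h1, ?_⟩, by simp⟩
    rw [card_insert_of_notMem h4, h2]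
  · rintro ⟨A, b⟩ h
    simp only [mem_sigma] at h
    simp [insert_erase h.2]
  · rintro ⟨A, b⟩ h
    simp only [mem_sigma, mem_sdiff] at h
    simp [erase_insert h.2.2]
  · rintro ⟨A, b⟩ h
    simp only [mem_sigma] at h
    simp [insert_erase h.2, mul_comm]

open Finset in
theorem up_injective {α : Type*} [DecidableEq α] (Ω : Finset α) (k : ℕ) (hk : 2 * k < Ω.card)
    (f : Finset α → ℚ)
    (hf : ∀ B ⊆ Ω, B.card = k + 1 → ∑ b ∈ B, f (B.erase b) = 0) :
    ∀ A ⊆ Ω, A.card = k → f A = 0 := by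
  have key : ∀ A ⊆ Ω, A.card = k →
      ∑ b ∈ A, ∑ a ∈ Ω \ (A.erase b), f (insert a (A.erase b)) =
        - ((Ω.card : ℚ) - 2 * k) * f A := by
    intro A hA hAk
    have h1 : ∑ a ∈ Ω \ A, ∑ b ∈ insert a A, f ((insert a A).erase b) = 0 := by
      refine Finset.sum_eq_zero fun a ha => ?_
      rw [mem_sdiff] at ha
      exact hf _ (insert_subset ha.1 hA) (by rw [card_insert_of_notMem ha.2, hAk])
    have h2 : ∑ a ∈ Ω \ A, ∑ b ∈ insert a A, f ((insert a A).erase b) =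
        ((Ω.card : ℚ) - k) * f A + ∑ a ∈ Ω \ A, ∑ b ∈ A, f (insert a (A.erase b)) := by
      have hc : ((Ω \ A).card : ℚ) = (Ω.card : ℚ) - k := by
        rw [card_sdiff_of_subset hA, Nat.cast_sub (card_le_card hA), hAk]
      rw [← hc, ← nsmul_eq_mul, ← Finset.sum_const, ← Finset.sum_add_distrib]
      refine Finset.sum_congr rfl fun a ha => ?_
      rw [mem_sdiff] at ha
      rw [sum_insert ha.2, erase_insert ha.2]
      congr 1
      refine Finset.sum_congr rfl fun b hb => ?_
      rw [erase_insert_of_ne]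
      rintro rfl; exact ha.2 hb
    have h3 : ∑ b ∈ A, ∑ a ∈ Ω \ (A.erase b), f (insert a (A.erase b)) =
        (k : ℚ) * f A + ∑ b ∈ A, ∑ a ∈ Ω \ A, f (insert a (A.erase b)) := by
      rw [← hAk, ← nsmul_eq_mul, ← Finset.sum_const, ← Finset.sum_add_distrib]
      refine Finset.sum_congr rfl fun b hb => ?_
      have : Ω \ (A.erase b) = insert b (Ω \ A) := by
        ext x
        simp only [mem_sdiff, mem_erase, mem_insert]
        by_cases hx : x = b
        · subst hx; simp [hA hb]
        · simp [hx]
      rw [this, sum_insert (by simp [hb]), insert_erase hb]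
    rw [Finset.sum_comm] at h2
    rw [h3]
    linarith
  have hadj := adj_aux Ω k f (fun E => ∑ a ∈ Ω \ E, f (insert a E))
  have hL : ∑ A ∈ Ω.powerset with A.card = k,
      f A * ∑ b ∈ A, ∑ a ∈ Ω \ (A.erase b), f (insert a (A.erase b)) =
      - ((Ω.card : ℚ) - 2 * k) * ∑ A ∈ Ω.powerset with A.card = k, f A ^ 2 := by
    rw [Finset.mul_sum]
    refine Finset.sum_congr rfl fun A hA => ?_
    simp only [mem_filter, mem_powerset] at hA
    rw [key A hA.1 hA.2]; ring
  rw [hL] at hadj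
  have hR : 0 ≤ ∑ E ∈ Ω.powerset with E.card + 1 = k,
      (∑ a ∈ Ω \ E, f (insert a E)) * ∑ a ∈ Ω \ E, f (insert a E) :=
    Finset.sum_nonneg fun _ _ => mul_self_nonneg _
  have hpos : (0 : ℚ) < (Ω.card : ℚ) - 2 * k := by
    have : ((2 * k : ℕ) : ℚ) < Ω.card := by exact_mod_cast hk
    push_cast at this; linarith
  have hS : 0 ≤ ∑ A ∈ Ω.powerset with A.card = k, f A ^ 2 :=
    Finset.sum_nonneg fun _ _ => sq_nonneg _
  have hS0 : ∑ A ∈ Ω.powerset with A.card = k, f A ^ 2 = 0 := by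
    nlinarith
  intro A hA hAk
  have := (Finset.sum_eq_zero_iff_of_nonneg (fun _ _ => sq_nonneg _)).1 hS0 A
    (by simp [hA, hAk])
  exact pow_eq_zero_iff (two_ne_zero) |>.1 this

/-- `G` is transitive on the `k`-subsets of `Ω`. -/
def HomOn {α : Type*} [DecidableEq α] (G : Subgroup (Equiv.Perm α)) (Ω : Finset α) (k : ℕ) :
    Prop :=
  ∀ A ⊆ Ω, A.card = k → ∀ B ⊆ Ω, B.card = k → ∃ g ∈ G, A.image g = B

open Finset in
theorem HomOn.step {α : Type*} [DecidableEq α] {G : Subgroup (Equiv.Perm α)} {Ω : Finset α}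
    {k : ℕ} (hk : 2 * k < Ω.card) (h : HomOn G Ω (k + 1)) : HomOn G Ω k := by
  classical
  intro A hA hAk A' hA' hAk'
  let f : Finset α → ℚ := fun X => if ∃ g ∈ G, A.image g = X then 1 else 0
  have finv : ∀ g ∈ G, ∀ X, f (X.image g) = f X := by
    intro g hg X
    have : (∃ g' ∈ G, A.image g' = X.image g) ↔ (∃ g' ∈ G, A.image g' = X) := by
      constructor
      · rintro ⟨g', hg', e⟩
        refine ⟨g⁻¹ * g', G.mul_mem (G.inv_mem hg) hg', ?_⟩
        rw [Equiv.Perm.coe_mul, ← Finset.image_image, e, Finset.image_image,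
          ← Equiv.Perm.coe_mul]
        simp
      · rintro ⟨g', hg', e⟩
        refine ⟨g * g', G.mul_mem hg hg', ?_⟩
        rw [Equiv.Perm.coe_mul, ← Finset.image_image, e]
    simp only [f, this]
  obtain ⟨B0, hB0, hB0k⟩ := Finset.exists_subset_card_eq (s := Ω) (n := k + 1) (by omega)
  set c : ℚ := ∑ b ∈ B0, f (B0.erase b) with hc
  have hconst : ∀ B ⊆ Ω, B.card = k + 1 → ∑ b ∈ B, f (B.erase b) = c := by
    intro B hB hBk
    obtain ⟨g, hg, rfl⟩ := h B0 hB0 hB0k B hB hBk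
    rw [Finset.sum_image (fun _ _ _ _ e => g.injective e), hc]
    refine Finset.sum_congr rfl fun b _ => ?_
    rw [← Finset.image_erase g.injective, finv g hg]
  have hz := up_injective Ω k hk (fun X => f X - c / (k + 1)) (by
    intro B hB hBk
    rw [Finset.sum_sub_distrib, hconst B hB hBk, Finset.sum_const, hBk, nsmul_eq_mul]
    have : (k : ℚ) + 1 ≠ 0 := by positivity
    push_cast
    field_simp
    ring)
  have e1 := hz A hA hAk
  have e2 := hz A' hA' hAk'
  have e3 : f A = 1 := by
    simp only [f]; rw [if_pos ⟨1, G.one_mem, by simp⟩]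
  have e4 : f A' = 1 := by linarith
  by_contra hne
  simp only [f, if_neg hne] at e4
  norm_num at e4

theorem HomOn.down {α : Type*} [DecidableEq α] {G : Subgroup (Equiv.Perm α)} {Ω : Finset α}
    {d j : ℕ} (hd : 2 * d ≤ Ω.card + 1) (h : HomOn G Ω d) (hj : j ≤ d) : HomOn G Ω j := by
  induction hj using Nat.decreasingInduction with
  | self => exact h
  | of_succ k hk ih => exact ih.step (by omega)

open Finset Pointwise in
theorem HomOn.choose_dvd {α : Type*} [DecidableEq α] [Finite α] {G : Subgroup (Equiv.Perm α)}
    {Ω : Finset α} {j : ℕ} (hG : ∀ g ∈ G, Ω.image g = Ω) (h : HomOn G Ω j)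
    (hj : j ≤ Ω.card) : Ω.card.choose j ∣ Nat.card G := by
  obtain ⟨A, hA, hAk⟩ := Finset.exists_subset_card_eq hj
  have horb : MulAction.orbit G A = (Ω.powersetCard j : Set (Finset α)) := by
    ext B
    simp only [MulAction.mem_orbit_iff, mem_coe, mem_powersetCard]
    constructor
    · rintro ⟨⟨g, hg⟩, rfl⟩
      change A.image g ⊆ Ω ∧ (A.image g).card = j
      refine ⟨?_, by rw [card_image_of_injective _ g.injective, hAk]⟩
      rw [← hG g hg]
      exact image_subset_image hA
    · rintro ⟨h1, h2⟩
      obtain ⟨g, hg, e⟩ := h A hA hAk B h1 h2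
      exact ⟨⟨g, hg⟩, e⟩
  have := MulAction.index_stabilizer G A
  rw [horb, Set.ncard_coe_finset, card_powersetCard] at this
  rw [← this]
  exact Subgroup.index_dvd_card _

/-- The permutations preserving a colouring. -/
def colorGroup {α β : Type*} (f : α → β) : Subgroup (Equiv.Perm α) where
  carrier := {g | ∀ x, f (g x) = f x}
  one_mem' := fun _ => rfl
  mul_mem' := by
    intro a b ha hb x
    rw [Equiv.Perm.mul_apply, ha, hb]
  inv_mem' := by
    intro a ha x
    have := ha (a⁻¹ x)
    simpa using this.symm

theorem mem_colorGroup {α β : Type*} {f : α → β} {g : Equiv.Perm α} :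
    g ∈ colorGroup f ↔ ∀ x, f (g x) = f x := Iff.rfl

theorem card_block_s9 (n d : ℕ) (hd : 1 ≤ d) (t : ℕ) (ht : t < n / d) :
    (Finset.univ.filter fun x : Fin n => (x : ℕ) / d = t).card = d := by
  have hn : (t + 1) * d ≤ n := (Nat.mul_le_mul_right d ht).trans (Nat.div_mul_le_self n d)
  have : (Finset.univ.filter fun x : Fin n => (x : ℕ) / d = t).map Fin.valEmbedding =
      Finset.Ico (t * d) ((t + 1) * d) := by
    ext y
    simp only [Finset.mem_map, Finset.mem_filter, Finset.mem_univ, true_and, Finset.mem_Ico,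
      Fin.valEmbedding_apply]
    constructor
    · rintro ⟨x, hx, rfl⟩
      exact ⟨(Nat.le_div_iff_mul_le hd).1 hx.ge, (Nat.div_lt_iff_lt_mul hd).1 (by omega)⟩
    · intro hy
      refine ⟨⟨y, by omega⟩, ?_, rfl⟩
      have h1 := (Nat.le_div_iff_mul_le hd).2 hy.1
      have h2 := (Nat.div_lt_iff_lt_mul hd).2 hy.2
      change y / d = t
      omega
  rw [← Finset.card_map Fin.valEmbedding, this, Nat.card_Ico, Nat.succ_mul]
  omega

theorem card_ge (n m : ℕ) :
    (Finset.univ.filter fun x : Fin n => m ≤ (x : ℕ)).card = n - m := by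
  have : (Finset.univ.filter fun x : Fin n => m ≤ (x : ℕ)).map Fin.valEmbedding =
      Finset.Ico m n := by
    ext y
    simp only [Finset.mem_map, Finset.mem_filter, Finset.mem_univ, true_and, Finset.mem_Ico,
      Fin.valEmbedding_apply]
    constructor
    · rintro ⟨x, hx, rfl⟩
      exact ⟨hx, x.2⟩
    · intro hy
      exact ⟨⟨y, hy.2⟩, hy.1, rfl⟩
  rw [← Finset.card_map Fin.valEmbedding, this, Nat.card_Ico]

theorem card_colorGroup (n d : ℕ) (hd : 1 ≤ d) :
    Nat.card (colorGroup fun x : Fin n => (x : ℕ) / d) =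
      (Nat.factorial d) ^ (n / d) * Nat.factorial (n % d) := by
  let f : Fin n → Fin (n / d + 1) := fun x =>
    ⟨(x : ℕ) / d, Nat.lt_succ_of_le (Nat.div_le_div_right x.2.le)⟩
  have h1 : Nat.card (colorGroup fun x : Fin n => (x : ℕ) / d) =
      Nat.card {g : Equiv.Perm (Fin n) // f ∘ g = f} := by
    refine Nat.card_congr (Equiv.subtypeEquivRight fun g => ?_)
    rw [mem_colorGroup, funext_iff]
    simp [f, Fin.ext_iff]
  rw [h1, Nat.card_eq_fintype_card, DomMulAct.stabilizer_card f, Fin.prod_univ_castSucc]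
  congr 1
  · rw [Finset.prod_congr rfl (g := fun _ => Nat.factorial d)]
    · simp
    · intro t _
      congr 1
      rw [Fintype.card_subtype]
      refine Eq.trans ?_ (card_block_s9 n d hd t t.2)
      congr 1
      ext x
      simp [f, Fin.ext_iff]
  · congr 1
    rw [Fintype.card_subtype]
    have h2 := card_ge n (n / d * d)
    have h3 := Nat.div_add_mod n d
    have : n - n / d * d = n % d := by rw [mul_comm]; omega
    rw [← this, ← h2]
    congr 1
    ext x
    simp only [f, Fin.ext_iff, Finset.mem_filter, Finset.mem_univ, true_and, Fin.val_last]
    rw [← Nat.le_div_iff_mul_le hd]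
    have := Nat.div_le_div_right (c := d) x.2.le
    omega

theorem exists_perm_image {α : Type*} [DecidableEq α] [Fintype α] (Ω U A : Finset α)
    (hU : U ⊆ Ω) (hA : A ⊆ Ω) (h : U.card = A.card) :
    ∃ σ : Equiv.Perm α, (∀ x, x ∉ Ω → σ x = x) ∧ (∀ x, x ∈ Ω → σ x ∈ Ω) ∧
      ∀ x ∈ U, σ x ∈ A := by
  let e : {y : {x // x ∈ Ω} // y.1 ∈ U} ≃ {y : {x // x ∈ Ω} // y.1 ∈ A} :=
    (Equiv.subtypeSubtypeEquivSubtype (p := (· ∈ Ω)) (q := (· ∈ U)) (fun h => hU h)).trans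
      ((Finset.equivOfCardEq h).trans
        (Equiv.subtypeSubtypeEquivSubtype (p := (· ∈ Ω)) (q := (· ∈ A)) (fun h => hA h)).symm)
  refine ⟨Equiv.Perm.ofSubtype e.extendSubtype, ?_, ?_, ?_⟩
  · intro x hx
    exact Equiv.Perm.ofSubtype_apply_of_not_mem _ hx
  · intro x hx
    rw [Equiv.Perm.ofSubtype_apply_of_mem _ hx]
    exact Subtype.coe_prop _
  · intro x hx
    rw [Equiv.Perm.ofSubtype_apply_of_mem _ (hU hx)]
    exact e.extendSubtype_mem ⟨x, hU hx⟩ hx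

/-- Divisibility conditions for optimal subgroup codes: if a subgroup code
`C ≤ S_n` of minimum ℓ∞-distance at least `d`, `1 ≤ d ≤ n`, attains
`|C| ⬝ (d!)^⌊n/d⌋ ⬝ (n mod d)! = n!`, then
`lcm{K_{n-i⬝d,d} : 0 ≤ i ≤ (n-2d+1)/d}` divides `|C|`.
(The condition `i ≤ (n-2d+1)/d` for an integer `i ≥ 0` is expressed as
`i⬝d + 2⬝d ≤ n + 1`.) -/
theorem optimal_subgroup_code_divisibility (n d : ℕ) (hd : 1 ≤ d) (hdn : d ≤ n)
    (C : Subgroup (Equiv.Perm (Fin n)))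
    (hC : ∀ f ∈ C, ∀ g ∈ C, f ≠ g → d ≤ dinf f g)
    (hopt : Nat.card C * (Nat.factorial d) ^ (n / d) * Nat.factorial (n % d) =
      Nat.factorial n) :
    (((Finset.range (n + 1)).filter fun i => i * d + 2 * d ≤ n + 1).lcm
        fun i => Kconst (n - i * d) d) ∣ Nat.card C := by
  classical
  set H : Subgroup (Equiv.Perm (Fin n)) := colorGroup fun x : Fin n => (x : ℕ) / d with hH
  have hdisj : Disjoint C H := by
    rw [Subgroup.disjoint_def]
    intro g hg hgH
    by_contra hne
    have h1 := hC g hg 1 C.one_mem hne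
    have h2 : dinf g 1 < d := by
      rw [dinf, Finset.sup_lt_iff (by rw [Nat.bot_eq_zero]; omega)]
      intro x _
      have h3 : (g x : ℕ) / d = (x : ℕ) / d := hgH x
      have h4 := Nat.div_add_mod (g x : ℕ) d
      have h5 := Nat.div_add_mod (x : ℕ) d
      have h6 := Nat.mod_lt (g x : ℕ) hd
      have h7 := Nat.mod_lt (x : ℕ) hd
      rw [h3] at h4
      simp only [Equiv.Perm.coe_one, id_eq]
      omega
    omega
  have hcompl : Subgroup.IsComplement' C H := by
    apply Subgroup.isComplement'_of_card_mul_and_disjoint _ hdisj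
    rw [card_colorGroup n d hd, ← mul_assoc, hopt, Nat.card_eq_fintype_card, Fintype.card_perm,
      Fintype.card_fin]
  refine Finset.lcm_dvd fun i hi => ?_
  rw [Finset.mem_filter] at hi
  have hi := hi.2
  rw [Kconst]
  refine Finset.lcm_dvd fun j hj => ?_
  rw [Finset.mem_Icc] at hj
  set G : Subgroup (Equiv.Perm (Fin n)) :=
    C ⊓ colorGroup (fun x : Fin n => min ((x : ℕ) / d) i) with hG
  refine dvd_trans ?_ (Subgroup.card_dvd_of_le (inf_le_left : G ≤ C))
  set Ω : Finset (Fin n) := Finset.univ.filter fun x : Fin n => i * d ≤ (x : ℕ) with hΩ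
  have hmem : ∀ x, x ∈ Ω ↔ i ≤ (x : ℕ) / d := by
    intro x
    simp [hΩ, Nat.le_div_iff_mul_le hd]
  have hΩc : Ω.card = n - i * d := card_ge n (i * d)
  have hiq : i < n / d := by
    rw [Nat.lt_iff_add_one_le, Nat.le_div_iff_mul_le hd, Nat.add_mul]
    omega
  set U : Finset (Fin n) := Finset.univ.filter fun x : Fin n => (x : ℕ) / d = i with hU
  have hUc : U.card = d := card_block_s9 n d hd i hiq
  have hUΩ : U ⊆ Ω := by
    intro x hx
    rw [hmem]
    simp only [hU, Finset.mem_filter] at hx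
    exact hx.2.ge
  have base : ∀ A ⊆ Ω, A.card = d → ∃ g ∈ G, U.image g = A := by
    intro A hA hAd
    obtain ⟨σ, s1, s2, s3⟩ := exists_perm_image Ω U A hUΩ hA (hUc.trans hAd.symm)
    have hσ : ∀ x, min ((σ x : ℕ) / d) i = min ((x : ℕ) / d) i := by
      intro x
      by_cases hx : x ∈ Ω
      · have h1 := (hmem _).1 hx
        have h2 := (hmem _).1 (s2 x hx)
        omega
      · rw [s1 x hx]
    obtain ⟨⟨⟨c, hc⟩, ⟨h, hh⟩⟩, hch⟩ := hcompl.surjective σ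
    simp only at hch
    have hc' : c = σ * h⁻¹ := by rw [← hch]; simp
    have hh' : ∀ x, ((h⁻¹ x : Fin n) : ℕ) / d = (x : ℕ) / d := H.inv_mem hh
    refine ⟨c, ⟨hc, ?_⟩, ?_⟩
    · intro x
      change min ((c x : ℕ) / d) i = min ((x : ℕ) / d) i
      rw [hc', Equiv.Perm.mul_apply, hσ, hh']
    · apply Finset.eq_of_subset_of_card_le
      · intro y hy
        obtain ⟨x, hx, rfl⟩ := Finset.mem_image.1 hy
        rw [hc', Equiv.Perm.mul_apply]
        apply s3
        simp only [hU, Finset.mem_filter, Finset.mem_univ, true_and] at hx ⊢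
        rw [hh', hx]
      · rw [Finset.card_image_of_injective _ c.injective, hUc, hAd]
  have hom : HomOn G Ω d := by
    intro A hA hAd B hB hBd
    obtain ⟨g, hg, rfl⟩ := base A hA hAd
    obtain ⟨g', hg', rfl⟩ := base B hB hBd
    refine ⟨g' * g⁻¹, G.mul_mem hg' (G.inv_mem hg), ?_⟩
    rw [Finset.image_image, ← Equiv.Perm.coe_mul]
    simp
  have hinv : ∀ g ∈ G, Ω.image g = Ω := by
    intro g hg
    apply Finset.eq_of_subset_of_card_le
    · intro y hy
      obtain ⟨x, hx, rfl⟩ := Finset.mem_image.1 hy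
      rw [hmem] at hx ⊢
      have : min ((g x : ℕ) / d) i = min ((x : ℕ) / d) i := hg.2 x
      omega
    · rw [Finset.card_image_of_injective _ g.injective]
  have := (hom.down (by omega) hj.2).choose_dvd hinv (by omega)
  rwa [hΩc] at this
end

section
/- (Set–antiset bound) Let A, B ⊆ S_n be such that the only value which the ℓ∞-distance takes both on pairs of elements of A and on pairs of elements of B is 0, i.e., {d∞(f,g) : f,g ∈ A} ∩ {d∞(f,g) : f,g ∈ B} = {0}. Then |A| · |B| ≤ n!. -/
/-- The set of ℓ∞-distances occurring between (not necessarily distinct)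
elements of `A ⊆ S_n`. -/
def distSet {n : ℕ} (A : Set (Equiv.Perm (Fin n))) : Set ℕ :=
  {m : ℕ | ∃ f ∈ A, ∃ g ∈ A, dinf f g = m}

theorem dinf_mul_right {n : ℕ} (f g k : Equiv.Perm (Fin n)) :
    dinf (f * k) (g * k) = dinf f g := by
  unfold dinf
  apply le_antisymm
  · apply Finset.sup_le
    intro i _
    exact Finset.le_sup (f := fun i => (((f i : ℕ) : ℤ) - ((g i : ℕ) : ℤ)).natAbs)
      (Finset.mem_univ (k i))
  · apply Finset.sup_le
    intro i _
    have := Finset.le_sup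
      (f := fun i => ((((f * k) i : ℕ) : ℤ) - (((g * k) i : ℕ) : ℤ)).natAbs)
      (Finset.mem_univ (k⁻¹ i))
    simpa using this

theorem eq_of_dinf_eq_zero {n : ℕ} (f g : Equiv.Perm (Fin n)) (h : dinf f g = 0) : f = g := by
  ext i
  have := Finset.le_sup (f := fun i => (((f i : ℕ) : ℤ) - ((g i : ℕ) : ℤ)).natAbs)
    (Finset.mem_univ i)
  change _ ≤ dinf f g at this
  simp only [h] at this
  omega

/-- Set–antiset bound: if `A, B ⊆ S_n` satisfy `𝒟(A) ∩ 𝒟(B) = {0}`,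
then `|A| ⬝ |B| ≤ n!`. -/
theorem set_antiset_bound (n : ℕ) (A B : Set (Equiv.Perm (Fin n)))
    (h : distSet A ∩ distSet B = {0}) :
    Nat.card A * Nat.card B ≤ Nat.factorial n := by
  have hinj : Function.Injective
      (fun p : A × B => (p.1 : Equiv.Perm (Fin n))⁻¹ * (p.2 : Equiv.Perm (Fin n))) := by
    rintro ⟨⟨a, ha⟩, ⟨b, hb⟩⟩ ⟨⟨a', ha'⟩, ⟨b', hb'⟩⟩ hab
    have hab : a⁻¹ * b = a'⁻¹ * b' := hab
    have hq : a' * a⁻¹ = b' * b⁻¹ := by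
      have hb2 : b' = a' * (a⁻¹ * b) := by rw [hab]; group
      rw [hb2]; group
    have h1 := dinf_mul_right a' a a⁻¹
    have h2 := dinf_mul_right b' b b⁻¹
    rw [mul_inv_cancel] at h1 h2
    rw [hq, h2] at h1
    have h0 : dinf a' a ∈ distSet A ∩ distSet B :=
      ⟨⟨a', ha', a, ha, rfl⟩, ⟨b', hb', b, hb, h1⟩⟩
    rw [h] at h0
    have h0 : dinf a' a = 0 := h0
    have e1 := eq_of_dinf_eq_zero _ _ h0
    have e2 := eq_of_dinf_eq_zero _ _ (h1.trans h0)
    subst e1 e2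
    rfl
  have := Nat.card_le_card_of_injective _ hinj
  rw [Nat.card_prod, Nat.card_perm, Nat.card_fin] at this
  exact this
end

section
/- (Code–anticode bound) Let C ⊆ S_n satisfy d∞(f,g) ≥ d for all distinct f,g ∈ C, with |C| = M_C, and let A ⊆ S_n satisfy d∞(f,g) ≤ d−1 for all f,g ∈ A, with |A| = M_A. Then M_A · M_C ≤ n!. -/
theorem dinf_mul_right_le {n : ℕ} (f g h : Equiv.Perm (Fin n)) :
    dinf (f * h) (g * h) ≤ dinf f g := by
  unfold dinf
  refine Finset.sup_le fun i _ => ?_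
  exact Finset.le_sup (f := fun i => (((f i : ℕ) : ℤ) - ((g i : ℕ) : ℤ)).natAbs)
    (Finset.mem_univ (h i))

/-- Code–anticode bound: if `C ⊆ S_n` has minimum ℓ∞-distance at least `d`
and `A ⊆ S_n` has maximum ℓ∞-distance at most `d - 1`, then `|A| ⬝ |C| ≤ n!`. -/
theorem code_anticode_bound (n d : ℕ) (hd : 1 ≤ d)
    (C A : Finset (Equiv.Perm (Fin n)))
    (hC : ∀ f ∈ C, ∀ g ∈ C, f ≠ g → d ≤ dinf f g)
    (hA : ∀ f ∈ A, ∀ g ∈ A, dinf f g ≤ d - 1) :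
    A.card * C.card ≤ Nat.factorial n := by
  have hcard : (A ×ˢ C).card ≤ (Finset.univ : Finset (Equiv.Perm (Fin n))).card := by
    refine Finset.card_le_card_of_injOn (fun p => p.1⁻¹ * p.2) (fun _ _ => by simp) ?_
    rintro ⟨a, c⟩ hp ⟨b, e⟩ hq heq
    simp only [Finset.coe_product, Set.mem_prod, Finset.mem_coe] at hp hq heq
    have hc : c = a * (a⁻¹ * c) := by group
    have he : e = b * (a⁻¹ * c) := by rw [heq]; group
    have hle : dinf c e ≤ d - 1 := by
      have h1 := dinf_mul_right_le a b (a⁻¹ * c)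
      rw [← hc, ← he] at h1
      exact h1.trans (hA a hp.1 b hq.1)
    have hce : c = e := by
      by_contra hne
      have := hC c hp.2 e hq.2 hne
      omega
    subst hce
    have hab : a = b := inv_injective (mul_right_cancel heq)
    rw [hab]
  rw [Finset.card_product, Finset.card_univ, Fintype.card_perm, Fintype.card_fin] at hcard
  exact hcard
end

section
/- Let C ⊆ S_n satisfy d∞(f,g) ≥ d for all distinct f,g ∈ C, with |C| = M and 1 ≤ d ≤ n. Then M · (d!)^⌊n/d⌋ · (n mod d)! ≤ n!. -/
/-- The block containing a position. -/
def blk (n d : ℕ) (a : Fin n) : Fin (n / d + 1) :=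
  ⟨(a : ℕ) / d, Nat.lt_succ_of_le (Nat.div_le_div_right a.2.le)⟩

theorem blk_card (n d : ℕ) (hd : 1 ≤ d) (k : Fin (n / d + 1)) :
    Fintype.card {a : Fin n // blk n d a = k} = min n (k * d + d) - k * d := by
  rw [← Nat.card_Ico, ← Fintype.card_coe]
  apply Fintype.card_congr
  have key : ∀ a : ℕ, a / d = (k : ℕ) ↔ (k : ℕ) * d ≤ a ∧ a < k * d + d := by
    intro a
    rw [Nat.div_eq_iff (by omega)]
    constructor <;> rintro ⟨h1, h2⟩ <;> constructor <;> omega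
  refine
    { toFun := fun a => ⟨a.1.1, ?_⟩
      invFun := fun a => ⟨⟨a.1, ?_⟩, ?_⟩
      left_inv := fun a => rfl
      right_inv := fun a => rfl }
  · have h := (key a.1.1).1 (congrArg Fin.val a.2)
    have := a.1.2
    simp only [Finset.mem_Ico, lt_min_iff]
    omega
  · have h := a.2
    simp only [Finset.mem_Ico, lt_min_iff] at h
    omega
  · have h := a.2
    simp only [Finset.mem_Ico, lt_min_iff] at h
    exact Fin.ext ((key a.1).2 ⟨h.1, h.2.2⟩)

/-- If `C ⊆ S_n` has minimum ℓ∞-distance at least `d`, `1 ≤ d ≤ n`,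
then `|C| ⬝ (d!)^⌊n/d⌋ ⬝ (n mod d)! ≤ n!`. -/
theorem code_upper_bound (n d : ℕ) (hd : 1 ≤ d) (hdn : d ≤ n)
    (C : Finset (Equiv.Perm (Fin n)))
    (hC : ∀ f ∈ C, ∀ g ∈ C, f ≠ g → d ≤ dinf f g) :
    C.card * (Nat.factorial d) ^ (n / d) * Nat.factorial (n % d) ≤
      Nat.factorial n := by
  have hH : Fintype.card {g : Equiv.Perm (Fin n) // blk n d ∘ g = blk n d}
      = (Nat.factorial d) ^ (n / d) * Nat.factorial (n % d) := by
    rw [DomMulAct.stabilizer_card, Fin.prod_univ_castSucc]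
    have hm := Nat.div_add_mod' n d
    have hl := Nat.mod_lt n hd
    congr 1
    · rw [Finset.prod_congr rfl (g := fun _ => Nat.factorial d)]
      · simp
      · intro k _
        rw [blk_card n d hd]
        have : ((k : ℕ) + 1) * d ≤ n / d * d := Nat.mul_le_mul_right d k.2
        rw [Nat.add_mul] at this
        congr 1
        simp only [Fin.val_castSucc]
        omega
    · rw [blk_card n d hd]
      congr 1
      simp only [Fin.val_last]
      omega
  rw [mul_assoc, ← hH, ← Fintype.card_coe, ← Fintype.card_prod]
  have hn : Nat.factorial n = Fintype.card (Equiv.Perm (Fin n)) := by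
    rw [Fintype.card_perm, Fintype.card_fin]
  rw [hn]
  apply Fintype.card_le_of_injective
    (fun p : C × {g : Equiv.Perm (Fin n) // blk n d ∘ g = blk n d} => p.2.1 * p.1.1)
  rintro ⟨⟨f, hf⟩, ⟨g, hg⟩⟩ ⟨⟨f', hf'⟩, ⟨g', hg'⟩⟩ h
  simp only at h
  have hff : f = f' := by
    by_contra hne
    have h1 := hC f hf f' hf' hne
    have h2 : dinf f f' < d := by
      unfold dinf
      rw [Finset.sup_lt_iff (show (⊥ : ℕ) < d from hd)]
      intro i _
      have e : g (f i) = g' (f' i) := by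
        simpa using congrArg (fun q : Equiv.Perm (Fin n) => q i) h
      have e1 : blk n d (f i) = blk n d (f' i) := by
        rw [← congrFun hg (f i), ← congrFun hg' (f' i)]
        simp [e]
      have e2 : (f i : ℕ) / d = (f' i : ℕ) / d := congrArg Fin.val e1
      have a1 := Nat.div_add_mod (f i : ℕ) d
      have a2 := Nat.div_add_mod (f' i : ℕ) d
      have a3 := Nat.mod_lt (f i : ℕ) hd
      have a4 := Nat.mod_lt (f' i : ℕ) hd
      rw [e2] at a1
      omega
    omega
  subst hff
  have hgg : g = g' := mul_right_cancel h
  subst hgg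
  rfl
end

section
/- Let A ⊆ S_n satisfy d∞(f,g) ≤ d−1 for all f,g ∈ A, with |A| = M and d ≥ 1. Then M ≤ (d!)^(n/d); equivalently, M^d ≤ (d!)^n. -/
noncomputable def bphi (r : ℕ) : ℝ := Real.log (r.factorial : ℝ) / r

lemma bphi_nonneg (r : ℕ) : 0 ≤ bphi r := by
  unfold bphi
  apply div_nonneg _ (Nat.cast_nonneg _)
  apply Real.log_nonneg
  exact_mod_cast Nat.one_le_iff_ne_zero.mpr r.factorial_ne_zero

lemma mul_bphi (r : ℕ) : (r : ℝ) * bphi r = Real.log (r.factorial : ℝ) := by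
  unfold bphi
  rcases Nat.eq_zero_or_pos r with h | h
  · subst h; simp
  · have : (r : ℝ) ≠ 0 := by positivity
    field_simp

lemma log_fact_succ (r : ℕ) :
    Real.log ((r+1).factorial : ℝ) = Real.log ((r+1 : ℕ) : ℝ) + Real.log (r.factorial : ℝ) := by
  rw [Nat.factorial_succ, Nat.cast_mul, Real.log_mul]
  · positivity
  · exact_mod_cast r.factorial_ne_zero

lemma bphi_mono : Monotone bphi := by
  apply monotone_nat_of_le_succ
  intro r
  rcases Nat.eq_zero_or_pos r with h | h
  · subst h; simp [bphi]
  · have h1 := mul_bphi r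
    have h2 := mul_bphi (r+1)
    rw [log_fact_succ, ← h1] at h2
    have h3 : Real.log (r.factorial : ℝ) ≤ r * Real.log ((r+1 : ℕ) : ℝ) := by
      rw [← Real.log_pow]
      apply Real.log_le_log
      · exact_mod_cast r.factorial_pos
      · have : r.factorial ≤ (r+1)^r :=
          (Nat.factorial_le_pow r).trans (Nat.pow_le_pow_left (Nat.le_succ r) r)
        exact_mod_cast this
    rw [← h1] at h3
    have hr : (0 : ℝ) < r := by exact_mod_cast h
    have h4 : bphi r ≤ Real.log ((r+1 : ℕ) : ℝ) := le_of_mul_le_mul_left h3 hr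
    push_cast at h2 h4
    nlinarith

/-- Entropy-type inequality for the fibres of a map. -/
lemma fiber_ineq {γ β : Type} [DecidableEq β] (P : Finset γ) (v : γ → β)
    (R : Finset β) (hv : ∀ e ∈ P, v e ∈ R) (hP : P.Nonempty) :
    (P.card : ℝ) * Real.log P.card ≤
      ∑ e ∈ P, (Real.log R.card + Real.log ((P.filter (fun e' => v e' = v e)).card : ℝ)) := by
  have hp : (0 : ℝ) < P.card := by exact_mod_cast hP.card_pos
  have hR : (0 : ℝ) < R.card := by
    obtain ⟨e, he⟩ := hP
    exact_mod_cast Finset.card_pos.mpr ⟨_, hv e he⟩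
  have key : ∀ e ∈ P, 1 - (P.card : ℝ) / R.card *
      ((P.filter (fun e' => v e' = v e)).card : ℝ)⁻¹ + Real.log P.card ≤
      Real.log R.card + Real.log ((P.filter (fun e' => v e' = v e)).card : ℝ) := by
    intro e he
    have hq : (0 : ℝ) < ((P.filter (fun e' => v e' = v e)).card : ℝ) := by
      exact_mod_cast Finset.card_pos.mpr ⟨e, by simp [he]⟩
    set q := ((P.filter (fun e' => v e' = v e)).card : ℝ)
    have h := Real.one_sub_inv_le_log_of_pos (x := R.card * q / P.card) (by positivity)
    rw [Real.log_div (by positivity) hp.ne', Real.log_mul hR.ne' hq.ne'] at h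
    have h' : (R.card * q / P.card : ℝ)⁻¹ = (P.card : ℝ) / R.card * q⁻¹ := by
      field_simp
    rw [h'] at h
    linarith
  have hs := Finset.sum_le_sum key
  refine le_trans ?_ hs
  have hinv : ∑ e ∈ P, ((P.filter (fun e' => v e' = v e)).card : ℝ)⁻¹ ≤ R.card := by
    rw [← Finset.sum_fiberwise_of_maps_to hv]
    rw [Finset.card_eq_sum_ones, Nat.cast_sum]
    apply Finset.sum_le_sum
    intro k _
    have : ∀ e ∈ P.filter (fun e => v e = k),
        ((P.filter (fun e' => v e' = v e)).card : ℝ)⁻¹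
          = ((P.filter (fun e' => v e' = k)).card : ℝ)⁻¹ := by
      intro e he
      rw [(Finset.mem_filter.mp he).2]
    rw [Finset.sum_congr rfl this, Finset.sum_const, nsmul_eq_mul]
    simpa using mul_inv_le_one
  rw [Finset.sum_add_distrib, Finset.sum_sub_distrib, ← Finset.mul_sum]
  simp only [Finset.sum_const, nsmul_eq_mul, mul_one]
  have : (P.card : ℝ) / R.card * ∑ e ∈ P, ((P.filter (fun e' => v e' = v e)).card : ℝ)⁻¹
      ≤ P.card := by
    calc _ ≤ (P.card : ℝ) / R.card * R.card := by gcongr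
      _ = P.card := by field_simp
  linarith

/-- The contribution of a single row. -/
lemma row_sum {β : Type} [Fintype β] [DecidableEq β] (R : Finset β) (b : β) (hb : b ∈ R) :
    Real.log R.card + ∑ k ∈ Finset.univ.erase b, bphi (R.erase k).card
      = Fintype.card β * bphi R.card := by
  have h1 : ∑ k ∈ Finset.univ.erase b, bphi (R.erase k).card
      = (∑ k ∈ R.erase b, bphi (R.card - 1)) + ∑ k ∈ Rᶜ, bphi R.card := by
    have : Finset.univ.erase b = (R.erase b) ∪ Rᶜ := by
      ext x; simp; grind
    rw [this, Finset.sum_union]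
    · congr 1
      · apply Finset.sum_congr rfl
        intro k hk
        rw [Finset.card_erase_of_mem (Finset.mem_of_mem_erase hk)]
      · apply Finset.sum_congr rfl
        intro k hk
        rw [Finset.erase_eq_of_notMem (by simpa using hk)]
    · rw [Finset.disjoint_left]; intro x hx; simp; exact Finset.mem_of_mem_erase hx
  rw [h1]
  simp only [Finset.sum_const, nsmul_eq_mul, Finset.card_erase_of_mem hb]
  rw [mul_bphi, Finset.card_compl, Nat.cast_sub (Finset.card_le_univ R), sub_mul, mul_bphi]
  obtain ⟨r, hr⟩ := Nat.exists_eq_succ_of_ne_zero (Finset.card_pos.mpr ⟨b, hb⟩).ne'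
  rw [hr, Nat.succ_eq_add_one, log_fact_succ, Nat.add_sub_cancel]
  ring

theorem bregman (n : ℕ) : ∀ (α β : Type) [Fintype α] [DecidableEq α] [Fintype β] [DecidableEq β],
    Fintype.card α = n → ∀ (R : α → Finset β) (P : Finset (α ≃ β)),
    (∀ e ∈ P, ∀ i, e i ∈ R i) → Real.log P.card ≤ ∑ i, bphi (R i).card := by
  induction n with
  | zero =>
    intro α β _ _ _ _ hn R P hP
    have : IsEmpty α := Fintype.card_eq_zero_iff.mp hn
    have hc : P.card ≤ 1 := by
      apply Finset.card_le_one.mpr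
      intro a _ b _
      ext i
      exact isEmptyElim i
    have : Real.log P.card ≤ 0 := Real.log_nonpos (by positivity) (by exact_mod_cast hc)
    exact this.trans (Finset.sum_nonneg fun i _ => bphi_nonneg _)
  | succ n ih =>
    intro α β _ _ _ _ hn R P hP
    rcases P.eq_empty_or_nonempty with hE | hne
    · subst hE; simp; exact Finset.sum_nonneg fun i _ => bphi_nonneg _
    -- minors
    have minor : ∀ (i : α) (k : β), Real.log ((P.filter (fun e => e i = k)).card : ℝ) ≤
        ∑ j ∈ Finset.univ.erase i, bphi ((R j).erase k).card := by
      intro i k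
      let g : {e // e ∈ P.filter (fun e => e i = k)} → ({x // x ≠ i} ≃ {y // y ≠ k}) :=
        fun e => e.1.subtypeEquiv (fun a => by
          have := (Finset.mem_filter.mp e.2).2
          exact not_congr ⟨fun h => h ▸ this, fun h => e.1.injective (h.trans this.symm)⟩)
      have hg : Function.Injective g := by
        intro e e' h
        apply Subtype.ext
        ext x
        by_cases hx : x = i
        · rw [hx, (Finset.mem_filter.mp e.2).2, (Finset.mem_filter.mp e'.2).2]
        · have := congrArg (fun f => (f ⟨x, hx⟩ : β)) h
          simpa [g] using this
      have hc : Fintype.card {x // x ≠ i} = n := by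
        rw [Fintype.card_subtype_compl, hn]; simp
      have := ih {x // x ≠ i} {y // y ≠ k} hc (fun j => (R j.1).subtype (fun y => y ≠ k))
        (Finset.univ.image g) (by
          intro e he j
          obtain ⟨e', _, rfl⟩ := Finset.mem_image.mp he
          simp only [Finset.mem_subtype]
          exact hP _ (Finset.mem_filter.mp e'.2).1 _)
      rw [Finset.card_image_of_injective _ hg, Finset.card_univ, Fintype.card_coe] at this
      refine this.trans (le_of_eq ?_)
      rw [← Finset.sum_subtype (Finset.univ.erase i) (p := fun x => x ≠ i) (by simp)
        (fun j => bphi ((R j).subtype (fun y => y ≠ k)).card)]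
      apply Finset.sum_congr rfl
      intro j _
      rw [Finset.card_subtype, Finset.filter_ne']
    have hp : (0 : ℝ) < P.card := by exact_mod_cast hne.card_pos
    have step1 : ∀ i : α, (P.card : ℝ) * Real.log P.card ≤
        ∑ e ∈ P, (Real.log (R i).card +
          ∑ j ∈ Finset.univ.erase i, bphi ((R j).erase (e i)).card) := by
      intro i
      refine (fiber_ineq P (fun e => e i) (R i) (fun e he => hP e he i) hne).trans ?_
      apply Finset.sum_le_sum
      intro e _
      have := minor i (e i)
      linarith
    have step2 := Finset.sum_le_sum (fun i (_ : i ∈ Finset.univ) => step1 i)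
    rw [Finset.sum_comm] at step2
    have step3 : ∀ e ∈ P, ∑ i, (Real.log (R i).card +
          ∑ j ∈ Finset.univ.erase i, bphi ((R j).erase (e i)).card)
          = (n+1 : ℕ) * ∑ j, bphi (R j).card := by
      intro e he
      rw [Finset.sum_add_distrib]
      rw [Finset.sum_comm' (t' := Finset.univ) (s' := fun j => Finset.univ.erase j)
        (by intro x y; simp [eq_comm])]
      rw [← Finset.sum_add_distrib, Finset.mul_sum]
      apply Finset.sum_congr rfl
      intro j _
      have hb : Fintype.card β = n + 1 := by rw [← Fintype.card_congr e, hn]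
      rw [← hb, ← row_sum (R j) (e j) (hP e he j)]
      congr 1
      apply Finset.sum_bij (fun x _ => e x)
      · intro a ha; simpa using ha
      · intro a _ b _ h; exact e.injective h
      · intro b hb
        refine ⟨e.symm b, ?_, by simp⟩
        simp only [Finset.mem_erase, Finset.mem_univ, and_true] at hb ⊢
        intro h; apply hb; rw [← h]; simp
      · intros; rfl
    rw [Finset.sum_congr rfl step3] at step2
    simp only [Finset.sum_const, nsmul_eq_mul, Finset.card_univ, hn] at step2
    have hn' : (0 : ℝ) < ((n+1 : ℕ) : ℝ) := by positivity
    have hpos : (0:ℝ) < ((n+1 : ℕ) : ℝ) * P.card := by positivity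
    refine le_of_mul_le_mul_left ?_ hpos
    calc _ = ((n+1 : ℕ) : ℝ) * (P.card * Real.log P.card) := by ring
      _ ≤ _ := step2
      _ = _ := by ring

/-- Any anticode `A ⊆ S_n` of maximum ℓ∞-distance at most `d - 1` satisfies
`|A| ≤ (d!)^(n/d)`, stated in the equivalent form `|A|^d ≤ (d!)^n`. -/
theorem anticode_upper_bound (n d : ℕ) (hd : 1 ≤ d)
    (A : Finset (Equiv.Perm (Fin n)))
    (hA : ∀ f ∈ A, ∀ g ∈ A, dinf f g ≤ d - 1) :
    A.card ^ d ≤ (Nat.factorial d) ^ n := by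
  rcases A.eq_empty_or_nonempty with hE | hne
  · subst hE
    simp [show d ≠ 0 by omega]
  have hb := bregman n (Fin n) (Fin n) (by simp) (fun i => A.image (fun f => f i)) A
    (fun e he i => Finset.mem_image_of_mem _ he)
  have hcard : ∀ i : Fin n, (A.image (fun f => f i)).card ≤ d := by
    intro i
    obtain ⟨f, hf, hmin⟩ := A.exists_min_image (fun f => f i) hne
    have hsub : (A.image (fun f => f i)).map Fin.valEmbedding
        ⊆ Finset.Ico (f i : ℕ) ((f i : ℕ) + d) := by
      intro x hx
      simp only [Finset.mem_map, Finset.mem_image] at hx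
      obtain ⟨_, ⟨g, hg, rfl⟩, rfl⟩ := hx
      have h1 : (f i : ℕ) ≤ (g i : ℕ) := hmin g hg
      have h2 : (((g i : ℕ) : ℤ) - ((f i : ℕ) : ℤ)).natAbs ≤ dinf g f :=
        Finset.le_sup (f := fun i => (((g i : ℕ) : ℤ) - ((f i : ℕ) : ℤ)).natAbs)
          (Finset.mem_univ i)
      have h3 := hA g hg f hf
      simp only [Fin.valEmbedding_apply, Finset.mem_Ico]
      omega
    have := Finset.card_le_card hsub
    simpa using this
  have h2 : ∑ i : Fin n, bphi (A.image (fun f => f i)).card ≤ n * bphi d := by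
    calc _ ≤ ∑ i : Fin n, bphi d := Finset.sum_le_sum fun i _ => bphi_mono (hcard i)
      _ = _ := by simp
  have h3 : (d : ℝ) * Real.log A.card ≤ n * Real.log (d.factorial : ℝ) := by
    rw [← mul_bphi]
    have : (0:ℝ) ≤ d := by positivity
    have := mul_le_mul_of_nonneg_left (hb.trans h2) this
    linarith
  rw [← Real.log_pow, ← Real.log_pow] at h3
  have hc : (0 : ℝ) < A.card := by exact_mod_cast hne.card_pos
  have hf : (0 : ℝ) < d.factorial := by exact_mod_cast d.factorial_pos
  have := (Real.log_le_log_iff (by positivity) (by positivity)).mp h3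
  exact_mod_cast this
end

section
/- Let n ≥ d ≥ 1 be integers and set r = n mod d. Then there exists a subset A ⊆ S_n with d∞(f,g) ≤ d−1 for all f,g ∈ A, whose cardinality is |A| = (d!)^(⌊n/d⌋−1) · (d−r)! · ⌊(d+r)/2⌋! · ⌈(d+r)/2⌉! / ( (⌊(d+r)/2⌋ − r)! · (⌈(d+r)/2⌉ − r)! ). -/
/-- Existence of an anticode of size `M` in `S_n`. -/
def HasAnti (d n M : ℕ) : Prop :=
  ∃ A : Finset (Equiv.Perm (Fin n)), (∀ f ∈ A, ∀ g ∈ A, dinf f g ≤ d - 1) ∧ A.card = M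

theorem dinf_le_iff {n : ℕ} (f g : Equiv.Perm (Fin n)) (k : ℕ) :
    dinf f g ≤ k ↔ ∀ i, (((f i : ℕ) : ℤ) - ((g i : ℕ) : ℤ)).natAbs ≤ k := by
  simp [dinf, Finset.sup_le_iff]

theorem hasAnti_step {d n M : ℕ} (h : HasAnti d n M) :
    HasAnti d (d + n) (Nat.factorial d * M) := by
  classical
  obtain ⟨A, hA, hc⟩ := h
  let F : Equiv.Perm (Fin d) × Equiv.Perm (Fin n) → Equiv.Perm (Fin (d + n)) :=
    fun x => finSumFinEquiv.permCongr (Equiv.Perm.sumCongrHom _ _ x)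
  have hF : Function.Injective F :=
    (Equiv.injective _).comp Equiv.Perm.sumCongrHom_injective
  refine ⟨((Finset.univ : Finset (Equiv.Perm (Fin d))) ×ˢ A).image F, ?_, ?_⟩
  · intro f hf g hg
    simp only [Finset.mem_image, Finset.mem_product, Finset.mem_univ, true_and] at hf hg
    obtain ⟨⟨f1, f2⟩, hf2, rfl⟩ := hf
    obtain ⟨⟨g1, g2⟩, hg2, rfl⟩ := hg
    have h2 := (dinf_le_iff _ _ _).1 (hA _ hf2 _ hg2)
    rw [dinf_le_iff]
    intro i
    obtain ⟨j, rfl⟩ := finSumFinEquiv.surjective i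
    rcases j with j | j
    · have h1 := (f1 j).isLt
      have h1' := (g1 j).isLt
      simp [F, Equiv.permCongr_apply, -finSumFinEquiv_apply_left] 
      simp
      omega
    · have := h2 j
      simp [F, Equiv.permCongr_apply, -finSumFinEquiv_apply_right]
      simpa using this
  · rw [Finset.card_image_of_injective _ hF, Finset.card_product, hc, Finset.card_univ,
      Fintype.card_perm, Fintype.card_fin]

theorem hasAnti_iter {d n M : ℕ} (h : HasAnti d n M) (k : ℕ) :
    HasAnti d (k * d + n) (Nat.factorial d ^ k * M) := by
  induction k with
  | zero => simpa using h
  | succ k ih =>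
    have := hasAnti_step ih
    rw [show d + (k * d + n) = (k + 1) * d + n by ring,
      show Nat.factorial d * (Nat.factorial d ^ k * M) = Nat.factorial d ^ (k + 1) * M by ring]
      at this
    exact this

theorem hasAnti_base (d r a b : ℕ) (hrd : r < d) (hab : a + b = d + r) :
    HasAnti d (d + r) (a.descFactorial r * b.descFactorial r * Nat.factorial (d - r)) := by
  classical
  have hcompl : ∀ e : (Fin r ↪ Fin a) × (Fin r ↪ Fin b),
      Nonempty (Fin (d - r) ≃ ((Set.range (e.1.sumMap e.2))ᶜ : Set (Fin a ⊕ Fin b))) := by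
    intro e
    refine ⟨Fintype.equivOfCardEq ?_⟩
    rw [Fintype.card_compl_set, Set.card_range_of_injective (e.1.sumMap e.2).injective]
    simp
    omega
  let E := fun e => (hcompl e).some
  let W : (Fin r ⊕ Fin r) ⊕ Fin (d - r) → Fin (d + r) :=
    Sum.elim (Sum.elim (fun x => ⟨x, by omega⟩) (fun x => ⟨d + x, by omega⟩))
      (fun y => ⟨r + y, by omega⟩)
  have hW : Function.Bijective W := by
    rw [Fintype.bijective_iff_injective_and_card]
    constructor
    · rintro ((x | x) | x) ((y | y) | y) h <;> simp [W, Fin.ext_iff] at h ⊢ <;> omega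
    · simp
      omega
  let w := Equiv.ofBijective W hW
  let p : Fin (d + r) ≃ Fin a ⊕ Fin b := Fintype.equivOfCardEq (by simp [hab])
  let Φ : ((Fin r ↪ Fin a) × (Fin r ↪ Fin b)) × Equiv.Perm (Fin (d - r)) →
      ((Fin r ⊕ Fin r) ⊕ Fin (d - r) ≃ Fin a ⊕ Fin b) := fun x =>
    (Equiv.sumCongr (Equiv.ofInjective _ (x.1.1.sumMap x.1.2).injective)
      (x.2.trans (E x.1))).trans (Equiv.Set.sumCompl _)
  have h1 : ∀ x i, Φ x (Sum.inl (Sum.inl i)) = Sum.inl (x.1.1 i) := by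
    intro x i; rfl
  have h2 : ∀ x i, Φ x (Sum.inl (Sum.inr i)) = Sum.inr (x.1.2 i) := by
    intro x i; rfl
  have h3 : ∀ x i, Φ x (Sum.inr i) = (E x.1 (x.2 i) : Fin a ⊕ Fin b) := by
    intro x i; rfl
  have hΦ : Function.Injective Φ := by
    rintro ⟨⟨e1, e2⟩, s⟩ ⟨⟨e1', e2'⟩, s'⟩ h
    have k1 : e1 = e1' := by
      ext i
      have := h1 ⟨⟨e1, e2⟩, s⟩ i
      rw [h, h1] at this
      simpa using congrArg Fin.val (Sum.inl_injective this).symm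
    have k2 : e2 = e2' := by
      ext i
      have := h2 ⟨⟨e1, e2⟩, s⟩ i
      rw [h, h2] at this
      simpa using congrArg Fin.val (Sum.inr_injective this).symm
    subst k1 k2
    have k3 : s = s' := by
      apply Equiv.ext
      intro i
      have := h3 ⟨⟨e1, e2⟩, s⟩ i
      rw [h, h3] at this
      exact ((E (e1, e2)).injective (Subtype.ext this)).symm
    rw [k3]
  let F := fun x => (p.trans (Φ x).symm).trans w
  have hF : Function.Injective F := by
    intro x y h
    apply hΦ
    have h' : ∀ i, F x i = F y i := fun i => by rw [h]
    have : (Φ x).symm = (Φ y).symm := by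
      apply Equiv.ext
      intro i
      have := h' (p.symm i)
      simpa [F] using this
    simpa using congrArg Equiv.symm this
  have bl : ∀ x i j, p i = Sum.inl j → (F x i : ℕ) < d := by
    intro x i j hj
    obtain ⟨z, hz⟩ : ∃ z, (Φ x).symm (p i) = z := ⟨_, rfl⟩
    have hz' : Φ x z = Sum.inl j := by rw [← hz, ← hj]; simp
    have hFz : F x i = W z := by simp [F, hz, w]
    rw [hFz]
    rcases z with (z | z) | z
    · simp [W]; omega
    · rw [h2] at hz'; simp at hz'
    · simp [W]; omega
  have br : ∀ x i j, p i = Sum.inr j → r ≤ (F x i : ℕ) := by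
    intro x i j hj
    obtain ⟨z, hz⟩ : ∃ z, (Φ x).symm (p i) = z := ⟨_, rfl⟩
    have hz' : Φ x z = Sum.inr j := by rw [← hz, ← hj]; simp
    have hFz : F x i = W z := by simp [F, hz, w]
    rw [hFz]
    rcases z with (z | z) | z
    · rw [h1] at hz'; simp at hz'
    · simp [W]; omega
    · simp [W]
  refine ⟨Finset.univ.image F, ?_, ?_⟩
  · intro f hf g hg
    simp only [Finset.mem_image, Finset.mem_univ, true_and] at hf hg
    obtain ⟨x, rfl⟩ := hf
    obtain ⟨y, rfl⟩ := hg
    rw [dinf_le_iff]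
    intro i
    have hx := (F x i).isLt
    have hy := (F y i).isLt
    rcases hj : p i with j | j
    · have := bl x i j hj
      have := bl y i j hj
      omega
    · have := br x i j hj
      have := br y i j hj
      omega
  · rw [Finset.card_image_of_injective _ hF, Finset.card_univ]
    simp [Fintype.card_prod, Fintype.card_embedding_eq, Fintype.card_perm]

/-- For `n ≥ d ≥ 1` and `r = n mod d` there exists an anticode `A ⊆ S_n` of
maximum ℓ∞-distance at most `d - 1` with cardinality
`(d!)^(⌊n/d⌋-1) ⬝ (d-r)! ⬝ ⌊(d+r)/2⌋! ⬝ ⌈(d+r)/2⌉! / ((⌊(d+r)/2⌋-r)! ⬝ (⌈(d+r)/2⌉-r)!)`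
(the exact division is expressed in multiplied-out form). -/
theorem large_anticode_exists (n d : ℕ) (hd : 1 ≤ d) (hdn : d ≤ n) :
    ∃ A : Finset (Equiv.Perm (Fin n)),
      (∀ f ∈ A, ∀ g ∈ A, dinf f g ≤ d - 1) ∧
      A.card * (Nat.factorial ((d + n % d) / 2 - n % d) *
          Nat.factorial ((d + n % d + 1) / 2 - n % d)) =
        (Nat.factorial d) ^ (n / d - 1) * Nat.factorial (d - n % d) *
          Nat.factorial ((d + n % d) / 2) * Nat.factorial ((d + n % d + 1) / 2) := by
  have hr : n % d < d := Nat.mod_lt _ hd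
  have hn : n = (n / d - 1) * d + (d + n % d) := by
    have h1 : 1 ≤ n / d := Nat.div_pos hdn hd
    obtain ⟨k, hk⟩ := Nat.exists_eq_add_of_le h1
    have h2 := Nat.div_add_mod n d
    rw [hk] at h2 ⊢
    rw [Nat.add_sub_cancel_left]
    nlinarith
  have h := hasAnti_iter (hasAnti_base d (n % d) ((d + n % d) / 2) ((d + n % d + 1) / 2) hr
    (by omega)) (n / d - 1)
  rw [← hn] at h
  obtain ⟨A, hA, hc⟩ := h
  refine ⟨A, hA, ?_⟩
  have ha := Nat.factorial_mul_descFactorial (n := (d + n % d) / 2) (k := n % d) (by omega)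
  have hb := Nat.factorial_mul_descFactorial (n := (d + n % d + 1) / 2) (k := n % d) (by omega)
  rw [hc, ← ha, ← hb]
  ring
end

section
/- Let C ⊆ S_n satisfy d∞(f,g) ≥ d for all distinct f,g ∈ C, with |C| = M and 1 ≤ d ≤ n, and set r = n mod d. Then M · (d!)^(⌊n/d⌋−1) · (d−r)! · ⌊(d+r)/2⌋! · ⌈(d+r)/2⌉! ≤ n! · (⌊(d+r)/2⌋ − r)! · (⌈(d+r)/2⌉ − r)!. -/
/-- Colouring of `ℕ` by four initial intervals with cut points `s₁ ≤ s₂ ≤ s₃ ≤ e`, followed by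
blocks of length `d`. -/
def blockCol (d e s₁ s₂ s₃ x : ℕ) : ℕ :=
  if x < s₁ then 0 else if x < s₂ then 1 else if x < s₃ then 2 else if x < e then 3
  else 4 + (x - e) / d

theorem card_interval_fin (n lo hi : ℕ) (h : hi ≤ n) (P : Fin n → Prop) [DecidablePred P]
    (hP : ∀ x : Fin n, P x ↔ lo ≤ (x : ℕ) ∧ (x : ℕ) < hi) :
    Fintype.card {x : Fin n // P x} = hi - lo := by
  rw [Fintype.card_subtype, ← Nat.card_Ico, ← Finset.card_map Fin.valEmbedding]
  congr 1
  ext y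
  simp only [Finset.mem_map, Finset.mem_filter, Finset.mem_univ, true_and, Fin.valEmbedding_apply,
    Finset.mem_Ico]
  constructor
  · rintro ⟨x, hx, rfl⟩
    exact (hP x).1 hx
  · intro hy
    exact ⟨⟨y, by omega⟩, (hP _).2 hy, rfl⟩

theorem blockCol_lt (d m e s₁ s₂ s₃ x : ℕ) (hd : 1 ≤ d) (hx : x < m * d + e) :
    blockCol d e s₁ s₂ s₃ x < m + 4 := by
  unfold blockCol
  have : e ≤ x → (x - e) / d < m := fun h => by
    rw [Nat.div_lt_iff_lt_mul (by omega)]; omega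
  split_ifs <;> omega

/-- Permutations preserving the block colouring. -/
def young (n d e s₁ s₂ s₃ : ℕ) : Finset (Equiv.Perm (Fin n)) :=
  Finset.univ.filter fun g => ∀ x, blockCol d e s₁ s₂ s₃ (g x) = blockCol d e s₁ s₂ s₃ x

theorem young_card (n d m e s₁ s₂ s₃ : ℕ) (hd : 1 ≤ d) (hn : n = m * d + e)
    (h1 : s₁ ≤ s₂) (h2 : s₂ ≤ s₃) (h3 : s₃ ≤ e) :
    (young n d e s₁ s₂ s₃).card = s₁.factorial * ((s₂ - s₁).factorial *
      ((s₃ - s₂).factorial * ((e - s₃).factorial * d.factorial ^ m))) := by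
  let f : Fin n → Fin (m + 4) := fun x =>
    ⟨blockCol d e s₁ s₂ s₃ x, blockCol_lt d m e s₁ s₂ s₃ x hd (hn ▸ x.2)⟩
  have key := DomMulAct.stabilizer_card f
  have h0 : (young n d e s₁ s₂ s₃).card = Fintype.card {g : Equiv.Perm (Fin n) // f ∘ g = f} := by
    rw [Fintype.card_subtype]
    unfold young
    congr 1
    ext g
    simp [funext_iff, f]
  rw [h0, key]
  have hz : ∀ x : ℕ, blockCol d e s₁ s₂ s₃ x = 0 ↔ 0 ≤ x ∧ x < s₁ := by
    intro x; unfold blockCol; grind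
  have ho : ∀ x : ℕ, blockCol d e s₁ s₂ s₃ x = 1 ↔ s₁ ≤ x ∧ x < s₂ := by
    intro x; unfold blockCol; grind
  have ht : ∀ x : ℕ, blockCol d e s₁ s₂ s₃ x = 2 ↔ s₂ ≤ x ∧ x < s₃ := by
    intro x; unfold blockCol; grind
  have hth : ∀ x : ℕ, blockCol d e s₁ s₂ s₃ x = 3 ↔ s₃ ≤ x ∧ x < e := by
    intro x; unfold blockCol; grind
  have hb : ∀ j x : ℕ, blockCol d e s₁ s₂ s₃ x = j + 4 ↔
      e + j * d ≤ x ∧ x < e + j * d + d := by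
    intro j x
    have h5 : e ≤ x → ((x - e) / d = j ↔ e + j * d ≤ x ∧ x < e + j * d + d) := fun h => by
      rw [Nat.div_eq_iff (by omega)]
      omega
    unfold blockCol
    by_cases hx : e ≤ x
    · rw [if_neg (by omega), if_neg (by omega), if_neg (by omega), if_neg (by omega),
        ← h5 hx]
      omega
    · grind
  have hle : e ≤ n := by rw [hn]; omega
  rw [Fin.prod_univ_succ, Fin.prod_univ_succ, Fin.prod_univ_succ, Fin.prod_univ_succ]
  rw [card_interval_fin n 0 s₁ (by omega) _ (fun x => by rw [← hz]; simp [f, Fin.ext_iff]),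
    card_interval_fin n s₁ s₂ (by omega) _ (fun x => by rw [← ho]; simp [f, Fin.ext_iff]),
    card_interval_fin n s₂ s₃ (by omega) _ (fun x => by rw [← ht, Fin.ext_iff]; rfl),
    card_interval_fin n s₃ e (by omega) _ (fun x => by rw [← hth, Fin.ext_iff]; rfl)]
  rw [Finset.prod_congr rfl (g := fun _ => d.factorial)]
  · simp
  · intro j _
    have hj : (j : ℕ) * d + d ≤ m * d := by
      have := Nat.mul_le_mul_right d (Nat.succ_le_of_lt j.2)
      rw [Nat.succ_mul] at this
      exact this
    rw [card_interval_fin n (e + j * d) (e + j * d + d) (by omega) _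
      (fun x => by rw [← hb]; simp [f, Fin.ext_iff])]
    congr 1
    omega

theorem young_mul {n d e s₁ s₂ s₃ : ℕ} {g h : Equiv.Perm (Fin n)}
    (hg : g ∈ young n d e s₁ s₂ s₃) (hh : h ∈ young n d e s₁ s₂ s₃) :
    g * h ∈ young n d e s₁ s₂ s₃ := by
  simp only [young, Finset.mem_filter, Finset.mem_univ, true_and, Equiv.Perm.mul_apply] at *
  intro x
  rw [hg, hh]

theorem young_inv {n d e s₁ s₂ s₃ : ℕ} {g : Equiv.Perm (Fin n)}
    (hg : g ∈ young n d e s₁ s₂ s₃) : g⁻¹ ∈ young n d e s₁ s₂ s₃ := by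
  simp only [young, Finset.mem_filter, Finset.mem_univ, true_and] at *
  intro x
  rw [← hg (g⁻¹ x)]
  simp

theorem anticode_arith (d r a x y y' z z' : ℕ) (hd : 1 ≤ d) (hra : r ≤ a) (had : a ≤ d)
    (hy : blockCol d (d + r) a (d + r) (d + r) y = blockCol d (d + r) a (d + r) (d + r) x)
    (hy' : blockCol d (d + r) a (d + r) (d + r) y' = blockCol d (d + r) a (d + r) (d + r) x)
    (hz : blockCol d (d + r) r d d z = blockCol d (d + r) r d d y)
    (hz' : blockCol d (d + r) r d d z' = blockCol d (d + r) r d d y') :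
    ((z : ℤ) - (z' : ℤ)).natAbs < d := by
  rw [← hy'] at hy
  clear hy'
  have h1 := Nat.div_add_mod (z - (d + r)) d
  have h2 := Nat.div_add_mod (z' - (d + r)) d
  have h3 := Nat.mod_lt (z - (d + r)) hd
  have h4 := Nat.mod_lt (z' - (d + r)) hd
  by_cases hb : d + r ≤ y
  · have hb' : d + r ≤ y' := by
      unfold blockCol at hy; grind
    have hc : d + r ≤ z := by
      unfold blockCol at hz; grind
    have hc' : d + r ≤ z' := by
      unfold blockCol at hz'; grind
    have e1 : (z - (d + r)) / d = (z' - (d + r)) / d := by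
      unfold blockCol at hy hz hz'
      rw [if_neg (by omega), if_neg (by omega), if_neg (by omega), if_neg (by omega),
        if_neg (by omega), if_neg (by omega), if_neg (by omega), if_neg (by omega)] at hy hz hz'
      omega
    rw [e1] at h1
    omega
  · have hzz : (y < r → z < r) ∧ (r ≤ y → y < d → r ≤ z ∧ z < d) ∧
        (d ≤ y → d ≤ z ∧ z < d + r) := by
      unfold blockCol at hz; grind
    have hyy : y' < d + r ∧ (y < a ↔ y' < a) := by
      unfold blockCol at hy; grind
    have hzz' : (y' < r → z' < r) ∧ (r ≤ y' → y' < d → r ≤ z' ∧ z' < d) ∧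
        (d ≤ y' → d ≤ z' ∧ z' < d + r) := by
      unfold blockCol at hz'; grind
    omega

theorem inter_arith (d r a x y : ℕ) (hra : r ≤ a) (had : a ≤ d)
    (hp : blockCol d (d + r) a (d + r) (d + r) y = blockCol d (d + r) a (d + r) (d + r) x)
    (hv : blockCol d (d + r) r d d y = blockCol d (d + r) r d d x) :
    blockCol d (d + r) r a d y = blockCol d (d + r) r a d x := by
  have hpp : y < a ↔ x < a := by
    unfold blockCol at hp; grind
  unfold blockCol at hv ⊢
  grind

theorem main_count (n d r a : ℕ) (hd : 1 ≤ d) (hra : r ≤ a) (had : a ≤ d)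
    (C : Finset (Equiv.Perm (Fin n)))
    (hC : ∀ f ∈ C, ∀ g ∈ C, f ≠ g → d ≤ dinf f g) :
    C.card * ((young n d (d + r) r d d).card * (young n d (d + r) a (d + r) (d + r)).card) ≤
      n.factorial * (young n d (d + r) r a d).card := by
  classical
  set H := young n d (d + r) r d d with hH
  set K := young n d (d + r) a (d + r) (d + r) with hK
  set J := young n d (d + r) r a d with hJ
  have hfib : ∀ b ∈ (Finset.univ : Finset (Equiv.Perm (Fin n))),
      ((C ×ˢ (H ×ˢ K)).filter fun t => (t.2.1 * t.2.2)⁻¹ * t.1 = b).card ≤ J.card := by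
    intro b _
    rcases Finset.eq_empty_or_nonempty
      ((C ×ˢ (H ×ˢ K)).filter fun t => (t.2.1 * t.2.2)⁻¹ * t.1 = b) with h0 | ⟨⟨c₀, h₀, k₀⟩, ht₀⟩
    · rw [h0]; simp
    simp only [Finset.mem_filter, Finset.mem_product] at ht₀
    obtain ⟨⟨hc₀, hh₀, hk₀⟩, hb₀⟩ := ht₀
    have main : ∀ c h k, c ∈ C → h ∈ H → k ∈ K → (h * k)⁻¹ * c = b →
        c = c₀ ∧ h * k = h₀ * k₀ := by
      intro c h k hc hh hk hb
      have e1 : c = h * k * b := by rw [← hb]; group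
      have e2 : c₀ = h₀ * k₀ * b := by rw [← hb₀]; group
      have hcc : c = c₀ := by
        by_contra hne
        have hle := hC c hc c₀ hc₀ hne
        have : dinf c c₀ < d := by
          unfold dinf
          rw [Finset.sup_lt_iff (show 0 < d from hd)]
          intro i _
          rw [e1, e2]
          simp only [hH, hK, young, Finset.mem_filter, Finset.mem_univ, true_and] at hh hk hh₀ hk₀
          exact anticode_arith d r a (b i) (k (b i)) (k₀ (b i)) _ _ hd hra had
            (hk _) (hk₀ _) (hh _) (hh₀ _)
        omega
      refine ⟨hcc, ?_⟩
      rw [e1, e2] at hcc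
      exact mul_right_cancel hcc
    refine Finset.card_le_card_of_injOn (fun t => h₀⁻¹ * t.2.1) ?_ ?_
    · rintro ⟨c, h, k⟩ ht
      simp only [Finset.coe_filter, Set.mem_ofPred_eq, Finset.mem_product] at ht
      obtain ⟨⟨hc, hh, hk⟩, hb⟩ := ht
      obtain ⟨-, hm⟩ := main c h k hc hh hk hb
      have m1 : h₀⁻¹ * h ∈ H := young_mul (young_inv hh₀) hh
      have m2 : h₀⁻¹ * h ∈ K := by
        have : h₀⁻¹ * h = k₀ * k⁻¹ := by
          rw [inv_mul_eq_iff_eq_mul, ← mul_assoc, ← hm]; group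
        rw [this]
        exact young_mul hk₀ (young_inv hk)
      show h₀⁻¹ * h ∈ J
      simp only [hH, hK, hJ, young, Finset.mem_filter, Finset.mem_univ, true_and] at m1 m2 ⊢
      exact fun x => inter_arith d r a _ _ hra had (m2 x) (m1 x)
    · rintro ⟨c, h, k⟩ ht ⟨c', h', k'⟩ ht' heq
      simp only [Finset.coe_filter, Set.mem_ofPred_eq, Finset.mem_product] at ht ht'
      obtain ⟨⟨hc, hh, hk⟩, hb⟩ := ht
      obtain ⟨⟨hc', hh', hk'⟩, hb'⟩ := ht'
      obtain ⟨q1, q2⟩ := main c h k hc hh hk hb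
      obtain ⟨q1', q2'⟩ := main c' h' k' hc' hh' hk' hb'
      have hhh : h = h' := mul_left_cancel heq
      subst hhh
      have : k = k' := mul_left_cancel (q2.trans q2'.symm)
      rw [q1, q1', this]
  have := Finset.card_le_mul_card_image_of_maps_to
    (f := fun t : Equiv.Perm (Fin n) × Equiv.Perm (Fin n) × Equiv.Perm (Fin n) =>
      (t.2.1 * t.2.2)⁻¹ * t.1) (s := C ×ˢ (H ×ˢ K)) (t := Finset.univ)
    (fun _ _ => Finset.mem_univ _) J.card hfib
  rw [Finset.card_product, Finset.card_product, Finset.card_univ, Fintype.card_perm,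
    Fintype.card_fin] at this
  rw [mul_comm n.factorial]
  exact this

theorem improved_code_upper_bound (n d : ℕ) (hd : 1 ≤ d) (hdn : d ≤ n)
    (C : Finset (Equiv.Perm (Fin n)))
    (hC : ∀ f ∈ C, ∀ g ∈ C, f ≠ g → d ≤ dinf f g) :
    C.card * (Nat.factorial d) ^ (n / d - 1) * Nat.factorial (d - n % d) *
        Nat.factorial ((d + n % d) / 2) * Nat.factorial ((d + n % d + 1) / 2) ≤
      Nat.factorial n * Nat.factorial ((d + n % d) / 2 - n % d) *
        Nat.factorial ((d + n % d + 1) / 2 - n % d) := by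
  have hr : n % d < d := Nat.mod_lt _ hd
  have hk : 1 ≤ n / d := Nat.div_pos hdn hd
  obtain ⟨m, hm⟩ : ∃ m, n / d = m + 1 := ⟨n / d - 1, by omega⟩
  have hn : n = m * d + (d + n % d) := by
    have := Nat.div_add_mod n d
    rw [hm] at this
    nlinarith
  rw [hm, Nat.add_sub_cancel]
  generalize n % d = r at *
  obtain ⟨a, ha⟩ : ∃ a, a = (d + r) / 2 := ⟨_, rfl⟩
  have e1 : (d + r + 1) / 2 = d + r - a := by omega
  have e2 : d + r - a - r = d - a := by omega
  rw [e1, ← ha, e2]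
  have key := main_count n d r a hd (by omega) (by omega) C hC
  rw [young_card n d m (d + r) r d d hd hn (by omega) (by omega) (by omega),
    young_card n d m (d + r) a (d + r) (d + r) hd hn (by omega) (by omega) (by omega),
    young_card n d m (d + r) r a d hd hn (by omega) (by omega) (by omega)] at key
  simp only [Nat.sub_self, Nat.factorial_zero, Nat.add_sub_cancel_left, one_mul] at key
  have hpos : 0 < r.factorial * r.factorial * d.factorial ^ m := by positivity
  refine Nat.le_of_mul_le_mul_right ?_ hpos
  calc _ = _ := by ring
    _ ≤ _ := key
    _ = _ := by ring
end

section
/- For every n ≥ 3, the maximal cardinality of a subset C ⊆ S_n with d∞(f,g) ≥ n−1 for all distinct f,g ∈ C equals 3. That is: every such C satisfies |C| ≤ 3, and there exists such a C with |C| = 3 (for instance C = {ι, (1 2 n), (1 n 2)}, the cyclic group of order 3 generated by the 3-cycle sending 1 ↦ 2, 2 ↦ n, n ↦ 1). -/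
lemma dinf_ge_iff {n : ℕ} (hn : 3 ≤ n) (f g : Equiv.Perm (Fin n)) :
    n - 1 ≤ dinf f g ↔ ∃ i, ((f i : ℕ) = 0 ∧ (g i : ℕ) = n - 1) ∨
      ((g i : ℕ) = 0 ∧ (f i : ℕ) = n - 1) := by
  unfold dinf
  rw [Finset.le_sup_iff (by simp; omega)]
  constructor
  · rintro ⟨i, -, hi⟩
    refine ⟨i, ?_⟩
    have := (f i).2
    have := (g i).2
    omega
  · rintro ⟨i, hi⟩
    refine ⟨i, Finset.mem_univ _, ?_⟩
    omega

lemma dinf_ge_imp {n : ℕ} (hn : 3 ≤ n) (f g : Equiv.Perm (Fin n)) (x z : Fin n)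
    (hx : (x : ℕ) = 0) (hz : (z : ℕ) = n - 1) (h : n - 1 ≤ dinf f g) :
    f.symm z = g.symm x ∨ g.symm z = f.symm x := by
  obtain ⟨i, ⟨h1, h2⟩ | ⟨h1, h2⟩⟩ := (dinf_ge_iff hn f g).1 h
  · right
    have e1 : f i = x := Fin.ext (by omega)
    have e2 : g i = z := Fin.ext (by omega)
    rw [← e1, ← e2]; simp
  · left
    have e1 : g i = x := Fin.ext (by omega)
    have e2 : f i = z := Fin.ext (by omega)
    rw [← e1, ← e2]; simp

/-- Four arcs cannot pairwise be head-to-tail: a tournament on four vertices has a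
transitive triple, which would force a loop. -/
lemma four_arcs {α : Type*} (a b : Fin 4 → α) (hne : ∀ i, b i ≠ a i)
    (h : ∀ i j, i ≠ j → b i = a j ∨ b j = a i) : False := by
  have h01 := h 0 1 (by decide)
  have h02 := h 0 2 (by decide)
  have h03 := h 0 3 (by decide)
  have h12 := h 1 2 (by decide)
  have h13 := h 1 3 (by decide)
  have h23 := h 2 3 (by decide)
  have n0 := hne 0
  have n1 := hne 1
  have n2 := hne 2
  have n3 := hne 3
  clear h hne
  grind

theorem optimal_code_dist_n_sub_one (n : ℕ) (hn : 3 ≤ n) :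
    (∀ C : Finset (Equiv.Perm (Fin n)),
        (∀ f ∈ C, ∀ g ∈ C, f ≠ g → n - 1 ≤ dinf f g) → C.card ≤ 3) ∧
    (∃ C : Finset (Equiv.Perm (Fin n)),
        (∀ f ∈ C, ∀ g ∈ C, f ≠ g → n - 1 ≤ dinf f g) ∧ C.card = 3) := by
  obtain ⟨x, hx⟩ : ∃ x : Fin n, (x : ℕ) = 0 := ⟨⟨0, by omega⟩, rfl⟩
  obtain ⟨y, hy⟩ : ∃ y : Fin n, (y : ℕ) = 1 := ⟨⟨1, by omega⟩, rfl⟩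
  obtain ⟨z, hz⟩ : ∃ z : Fin n, (z : ℕ) = n - 1 := ⟨⟨n - 1, by omega⟩, rfl⟩
  have hxy : x ≠ y := fun h => by subst h; omega
  have hxz : x ≠ z := fun h => by subst h; omega
  have hyz : y ≠ z := fun h => by subst h; omega
  constructor
  · intro C hC
    by_contra hcard
    have h4 : 4 ≤ C.card := by omega
    let F : Fin 4 → Equiv.Perm (Fin n) := fun i => (C.equivFin.symm (Fin.castLE h4 i)).1
    have hF : Function.Injective F := by
      intro i j hij
      have := C.equivFin.symm.injective (Subtype.ext hij)
      exact Fin.castLE_injective h4 this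
    have hm : ∀ i, F i ∈ C := fun i => (C.equivFin.symm (Fin.castLE h4 i)).2
    refine four_arcs (fun i => (F i).symm x) (fun i => (F i).symm z) ?_ ?_
    · intro i hi
      exact hxz ((F i).symm.injective hi).symm
    · intro i j hij
      exact dinf_ge_imp hn _ _ x z hx hz (hC _ (hm i) _ (hm j) (fun h => hij (hF h)))
  · obtain ⟨s, sx, sy, sz⟩ : ∃ s : Equiv.Perm (Fin n), s x = y ∧ s y = z ∧ s z = x := by
      refine ⟨Equiv.swap x y * Equiv.swap y z, ?_, ?_, ?_⟩ <;>
        simp [Equiv.swap_apply_def, hxy, hxz, hyz, hxy.symm, hxz.symm, hyz.symm]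
    obtain ⟨t, tx, ty, tz⟩ : ∃ t : Equiv.Perm (Fin n), t x = z ∧ t y = x ∧ t z = y := by
      refine ⟨s⁻¹, ?_, ?_, ?_⟩ <;> rw [Equiv.Perm.inv_eq_iff_eq] <;> simp [sx, sy, sz]
    have h1s : (1 : Equiv.Perm (Fin n)) ≠ s := by
      rintro rfl; exact hxy (by simpa using sx)
    have h1t : (1 : Equiv.Perm (Fin n)) ≠ t := by
      rintro rfl; exact hxz (by simpa using tx)
    have hst : s ≠ t := by
      rintro rfl; exact hyz (sx.symm.trans tx)
    refine ⟨{1, s, t}, ?_, Finset.card_eq_three.2 ⟨1, s, t, h1s, h1t, hst, rfl⟩⟩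
    intro f hf g hg hfg
    rw [dinf_ge_iff hn]
    simp only [Finset.mem_insert, Finset.mem_singleton] at hf hg
    rcases hf with rfl | rfl | rfl <;> rcases hg with rfl | rfl | rfl
    · exact absurd rfl hfg
    · exact ⟨z, Or.inr (by simp [sz, hx, hz])⟩
    · exact ⟨x, Or.inl (by simp [tx, hx, hz])⟩
    · exact ⟨z, Or.inl (by simp [sz, hx, hz])⟩
    · exact absurd rfl hfg
    · exact ⟨y, Or.inr (by simp [sy, ty, hx, hz])⟩
    · exact ⟨x, Or.inr (by simp [tx, hx, hz])⟩
    · exact ⟨y, Or.inl (by simp [sy, ty, hx, hz])⟩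
    · exact absurd rfl hfg
end

section
/- For all integers n ≥ 1 and r with (n−1)/2 ≤ r ≤ n−1, the cardinality of the ℓ∞-ball of radius r in S_n satisfies |B_{r,n}| ≤ (n!)^((2r+2−n)/n) · ∏_{i=r+1}^{n−1} (i!)^(2/i), where the right-hand side is interpreted as a real number with real exponents. -/
/-- The cardinality of a ball of radius `r` in `S_n` under the ℓ∞-metric
(the metric is right-invariant, so the size does not depend on the center;
we take the identity as the center). -/
noncomputable def ballCard (n r : ℕ) : ℕ :=
  Nat.card {g : Equiv.Perm (Fin n) | dinf g 1 ≤ r}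

/-- `log (k!) / k`. -/
noncomputable def bregG (k : ℕ) : ℝ := Real.log (Nat.factorial k) / k

lemma bregG_mul (k : ℕ) : (k : ℝ) * bregG k = Real.log (Nat.factorial k) := by
  unfold bregG
  rcases Nat.eq_zero_or_pos k with h | h
  · subst h; simp
  · have : (k : ℝ) ≠ 0 := by positivity
    field_simp

/-- Permutations supported on `A`. -/
def permSupp {n : ℕ} (A : Fin n → Finset (Fin n)) : Finset (Equiv.Perm (Fin n)) :=
  Finset.univ.filter fun s => ∀ i, s i ∈ A i

/-- The minor of `A` at `(i,k)`, kept in the same ambient dimension. -/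
def permMinor {n : ℕ} (A : Fin n → Finset (Fin n)) (i k : Fin n) : Fin n → Finset (Fin n) :=
  fun j => if j = i then {k} else (A j).erase k

lemma permSupp_minor {n : ℕ} (A : Fin n → Finset (Fin n)) (i k : Fin n) (hk : k ∈ A i) :
    permSupp (permMinor A i k) = (permSupp A).filter (fun s => s i = k) := by
  ext s
  rw [Finset.mem_filter]
  simp only [permSupp]
  rw [Finset.mem_filter, Finset.mem_filter]
  simp only [Finset.mem_univ, true_and, permMinor]
  constructor
  · intro h
    have hi : s i = k := by simpa using h i
    refine ⟨fun j => ?_, hi⟩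
    by_cases hj : j = i
    · subst hj; rw [hi]; exact hk
    · have := h j
      rw [if_neg hj] at this
      exact Finset.mem_of_mem_erase this
  · rintro ⟨h, hi⟩ j
    by_cases hj : j = i
    · subst hj; simp [hi]
    · rw [if_neg hj]
      refine Finset.mem_erase.2 ⟨?_, h j⟩
      rw [← hi]
      exact fun e => hj (s.injective e)

lemma xlogx_jensen {ι : Type*} (s : Finset ι) (hs : 0 < s.card) (x : ι → ℝ)
    (hx : ∀ i ∈ s, 0 ≤ x i) (hpos : 0 < ∑ i ∈ s, x i) :
    (∑ i ∈ s, x i) * Real.log (∑ i ∈ s, x i) ≤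
      (∑ i ∈ s, x i) * Real.log s.card + ∑ i ∈ s, x i * Real.log (x i) := by
  have hc : (0 : ℝ) < s.card := by exact_mod_cast hs
  have h := Real.convexOn_mul_log.map_sum_le (t := s) (w := fun _ => (s.card : ℝ)⁻¹) (p := x)
    (fun _ _ => by positivity) (by simp [hc.ne']) (fun i hi => hx i hi)
  simp only [smul_eq_mul, ← Finset.mul_sum] at h
  rw [Real.log_mul (by positivity) hpos.ne', Real.log_inv] at h
  have h2 := mul_le_mul_of_nonneg_left h hc.le
  have e1 : (s.card : ℝ) * ((s.card : ℝ)⁻¹ * (∑ i ∈ s, x i) *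
      (-Real.log s.card + Real.log (∑ i ∈ s, x i))) =
      (∑ i ∈ s, x i) * (-Real.log s.card + Real.log (∑ i ∈ s, x i)) := by
    field_simp
  have e2 : (s.card : ℝ) * ((s.card : ℝ)⁻¹ * ∑ i ∈ s, x i * Real.log (x i)) =
      ∑ i ∈ s, x i * Real.log (x i) := by
    field_simp
  rw [e1, e2] at h2
  linarith

/-- The combinatorial count in Schrijver's proof. -/
lemma row_count {n : ℕ} (U : Finset (Fin n)) (A : Fin n → Finset (Fin n))
    (hU : ∀ i, i ∉ U → ∃ k, A i = {k} ∧ ∀ j, j ≠ i → k ∉ A j)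
    (s : Equiv.Perm (Fin n)) (hs : ∀ i, s i ∈ A i) (j : Fin n) (hj : j ∈ U) :
    ((U.erase j).filter (fun i => s i ∈ A j)).card + 1 = (A j).card := by
  have e : (A j).erase (s j) = ((U.erase j).filter (fun i => s i ∈ A j)).map s.toEmbedding := by
    ext k
    simp only [Finset.mem_erase, Finset.mem_map, Finset.mem_filter, Equiv.coe_toEmbedding]
    constructor
    · rintro ⟨h1, h2⟩
      refine ⟨s.symm k, ⟨⟨?_, ?_⟩, by simpa using h2⟩, by simp⟩
      · intro h; apply h1; rw [← h]; simp
      · by_contra hc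
        obtain ⟨k', hk', hk2⟩ := hU _ hc
        have h3 := hs (s.symm k)
        rw [hk'] at h3
        simp only [Equiv.apply_symm_apply, Finset.mem_singleton] at h3
        subst h3
        refine hk2 j ?_ h2
        intro h; exact hc (h ▸ hj)
    · rintro ⟨i, ⟨⟨h1, h2⟩, h3⟩, rfl⟩
      exact ⟨fun h => h1 (s.injective h), h3⟩
  rw [← Finset.card_map s.toEmbedding, ← e, Finset.card_erase_add_one (hs j)]

lemma row_sum_s18 {n : ℕ} (U : Finset (Fin n)) (A : Fin n → Finset (Fin n))
    (hU : ∀ i, i ∉ U → ∃ k, A i = {k} ∧ ∀ j, j ≠ i → k ∉ A j)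
    (s : Equiv.Perm (Fin n)) (hs : ∀ i, s i ∈ A i) (j : Fin n) (hj : j ∈ U) :
    Real.log (A j).card + ∑ i ∈ U.erase j, bregG ((A j).erase (s i)).card =
      U.card * bregG (A j).card := by
  have hc := row_count U A hU s hs j hj
  set t := ((U.erase j).filter (fun i => s i ∈ A j)).card with ht
  have h1 : ∑ i ∈ U.erase j, bregG ((A j).erase (s i)).card =
      t * bregG t + ((U.erase j).filter (fun i => ¬ s i ∈ A j)).card * bregG (A j).card := by
    rw [← Finset.sum_filter_add_sum_filter_not (U.erase j) (fun i => s i ∈ A j)]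
    congr 1
    · rw [Finset.sum_congr rfl (g := fun _ => bregG t), Finset.sum_const, nsmul_eq_mul]
      intro i hi
      rw [Finset.card_erase_of_mem (Finset.mem_filter.1 hi).2, ← hc]
      rfl
    · rw [Finset.sum_congr rfl (g := fun _ => bregG (A j).card), Finset.sum_const, nsmul_eq_mul]
      intro i hi
      rw [Finset.erase_eq_of_notMem (Finset.mem_filter.1 hi).2]
  have h2 := Finset.card_filter_add_card_filter_not (s := U.erase j) (fun i => s i ∈ A j)
  have h3 := Finset.card_erase_add_one hj
  rw [h1, bregG_mul]
  have h4 : (U.card : ℝ) = ((U.erase j).filter (fun i => ¬ s i ∈ A j)).card + (A j).card := by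
    rw [← hc, ← h3, ← h2]; push_cast; ring
  rw [h4, add_mul, bregG_mul, ← hc, Nat.factorial_succ]
  push_cast
  rw [Real.log_mul (by positivity) (by positivity)]
  ring

theorem bregman_aux {n : ℕ} (m : ℕ) : ∀ (U : Finset (Fin n)) (A : Fin n → Finset (Fin n)),
    U.card = m →
    (∀ i, i ∉ U → ∃ k, A i = {k} ∧ ∀ j, j ≠ i → k ∉ A j) →
    (permSupp A).Nonempty →
    Real.log (permSupp A).card ≤ ∑ j ∈ U, bregG (A j).card := by
  induction m with
  | zero =>
    intro U A hm hU hne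
    rw [Finset.card_eq_zero] at hm
    subst hm
    have : (permSupp A).card ≤ 1 := by
      rw [Finset.card_le_one]
      intro s hs t ht
      ext i
      obtain ⟨k, hk, -⟩ := hU i (by simp)
      have h1 := (Finset.mem_filter.1 hs).2 i
      have h2 := (Finset.mem_filter.1 ht).2 i
      rw [hk, Finset.mem_singleton] at h1 h2
      rw [h1, h2]
    have h1 : (permSupp A).card = 1 := le_antisymm this hne.card_pos
    simp [h1]
  | succ m ih =>
    intro U A hm hU hne
    have memS : ∀ s, s ∈ permSupp A ↔ ∀ i, s i ∈ A i := fun s => by simp [permSupp]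
    have key : ∀ i ∈ U, ((permSupp A).card : ℝ) * Real.log (permSupp A).card ≤
        ∑ s ∈ permSupp A, (Real.log (A i).card +
          ∑ j ∈ U.erase i, bregG ((A j).erase (s i)).card) := by
      intro i hi
      have hfib : (permSupp A).card =
          ∑ k ∈ A i, ((permSupp A).filter (fun s => s i = k)).card :=
        Finset.card_eq_sum_card_fiberwise (fun s hs => (memS s).1 hs i)
      have hpos : (0 : ℝ) < (permSupp A).card := by exact_mod_cast hne.card_pos
      obtain ⟨s0, hs0⟩ := hne
      have hAi : 0 < (A i).card := Finset.card_pos.2 ⟨_, (memS s0).1 hs0 i⟩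
      have hfibR : ((permSupp A).card : ℝ) =
          ∑ k ∈ A i, (((permSupp A).filter (fun s => s i = k)).card : ℝ) := by
        exact_mod_cast hfib
      have hj := xlogx_jensen (A i) hAi
        (fun k => (((permSupp A).filter (fun s => s i = k)).card : ℝ))
        (fun _ _ => by positivity) (by rw [← hfibR]; exact hpos)
      rw [← hfibR] at hj
      refine hj.trans ?_
      rw [Finset.sum_add_distrib, Finset.sum_const, nsmul_eq_mul]
      refine add_le_add le_rfl ?_
      rw [← Finset.sum_fiberwise_of_maps_to (s := permSupp A) (t := A i) (g := fun s => s i)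
        (fun s hs => (memS s).1 hs i)]
      refine Finset.sum_le_sum fun k hk => ?_
      rw [Finset.sum_congr rfl (g := fun _ => ∑ j ∈ U.erase i, bregG ((A j).erase k).card),
        Finset.sum_const, nsmul_eq_mul]
      swap
      · intro s hs
        rw [(Finset.mem_filter.1 hs).2]
      rcases Finset.eq_empty_or_nonempty ((permSupp A).filter (fun s => s i = k)) with h0 | h0
      · simp [h0]
      refine mul_le_mul_of_nonneg_left ?_ (by positivity)
      rw [← permSupp_minor A i k hk] at h0 ⊢
      have := ih (U.erase i) (permMinor A i k) (by rw [Finset.card_erase_of_mem hi, hm]; rfl) ?_ h0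
      · refine this.trans (le_of_eq ?_)
        refine Finset.sum_congr rfl fun j hj => ?_
        simp [permMinor, Finset.ne_of_mem_erase hj]
      · intro j hj
        by_cases hji : j = i
        · subst hji
          refine ⟨k, by simp [permMinor], fun l hl => by simp [permMinor, hl]⟩
        · have hjU : j ∉ U := fun h => hj (Finset.mem_erase.2 ⟨hji, h⟩)
          obtain ⟨k', h1, h2⟩ := hU j hjU
          have hkk : k' ≠ k := by
            rintro rfl
            exact h2 i (Ne.symm hji) hk
          refine ⟨k', ?_, ?_⟩
          · simp only [permMinor, if_neg hji, h1]
            exact Finset.erase_eq_of_notMem (by simpa using hkk.symm)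
          · intro l hl
            by_cases hli : l = i
            · simp [permMinor, hli, hkk]
            · simp [permMinor, hli, h2 l hl]
    have hsum := Finset.sum_le_sum key
    rw [Finset.sum_const, nsmul_eq_mul, Finset.sum_comm] at hsum
    have hrhs : ∀ s ∈ permSupp A, ∑ i ∈ U, (Real.log (A i).card +
          ∑ j ∈ U.erase i, bregG ((A j).erase (s i)).card) =
          U.card * ∑ j ∈ U, bregG (A j).card := by
      intro s hs
      rw [Finset.mul_sum, Finset.sum_add_distrib]
      rw [Finset.sum_comm' (s := U) (t := fun i => U.erase i) (t' := U) (s' := fun j => U.erase j)]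
      · rw [← Finset.sum_add_distrib]
        exact Finset.sum_congr rfl fun j hj => row_sum_s18 U A hU s ((memS s).1 hs) j hj
      · intro x y
        simp only [Finset.mem_erase]
        constructor
        · rintro ⟨a, b, c⟩; exact ⟨⟨Ne.symm b, a⟩, c⟩
        · rintro ⟨⟨a, b⟩, c⟩; exact ⟨b, Ne.symm a, c⟩
    rw [Finset.sum_congr rfl hrhs, Finset.sum_const, nsmul_eq_mul] at hsum
    have hpos : (0 : ℝ) < (permSupp A).card := by exact_mod_cast hne.card_pos
    have hUpos : (0 : ℝ) < U.card := by rw [hm]; positivity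
    have : ((U.card : ℝ) * (permSupp A).card) * Real.log (permSupp A).card ≤
        ((U.card : ℝ) * (permSupp A).card) * ∑ j ∈ U, bregG (A j).card := by
      nlinarith [hsum]
    exact le_of_mul_le_mul_left this (by positivity)

/-- The rows of the band matrix. -/
def band (n r : ℕ) (i : Fin n) : Finset (Fin n) :=
  Finset.univ.filter fun j => (((j : ℕ) : ℤ) - ((i : ℕ) : ℤ)).natAbs ≤ r

lemma band_card (n r : ℕ) (i : Fin n) :
    (band n r i).card = (Finset.Ico ((i : ℕ) - r) (min n (i + r + 1))).card := by
  rw [← Finset.card_map Fin.valEmbedding]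
  congr 1
  ext k
  simp only [band, Finset.mem_map, Finset.mem_filter, Finset.mem_univ, true_and,
    Fin.valEmbedding_apply, Finset.mem_Ico]
  constructor
  · rintro ⟨j, h, rfl⟩
    have := j.2
    omega
  · intro h
    exact ⟨⟨k, by omega⟩, by simp only; omega, rfl⟩

lemma band_sum (n r : ℕ) (hr1 : n ≤ 2 * r + 1) (hr2 : r < n) :
    ∑ i : Fin n, bregG (band n r i).card =
      (2 * (r : ℝ) + 2 - n) * bregG n + ∑ i ∈ Finset.Icc (r + 1) (n - 1), 2 * bregG i := by
  simp only [band_card, Nat.card_Ico]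
  rw [Fin.sum_univ_eq_sum_range (fun i => bregG (min n (i + r + 1) - (i - r))) n]
  obtain ⟨a, b, hn, hr⟩ : ∃ a b, n = a + b + a ∧ r + 1 = a + b :=
    ⟨n - 1 - r, 2 * r + 2 - n, by omega, by omega⟩
  have hI : Finset.Icc (r + 1) (n - 1) = Finset.Ico (a + b) (a + b + a) := by
    ext k; simp only [Finset.mem_Icc, Finset.mem_Ico]; omega
  have hb : 2 * (r : ℝ) + 2 - n = b := by
    have : (r : ℝ) + 1 = a + b := by exact_mod_cast hr
    rw [hn]; push_cast; linarith
  rw [hI, hb, Finset.sum_Ico_eq_sum_range, ← Finset.mul_sum]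
  conv_lhs => rw [hn]
  rw [Finset.sum_range_add, Finset.sum_range_add]
  have e1 : ∑ x ∈ Finset.range a, bregG (min (a + b + a) (x + r + 1) - (x - r)) =
      ∑ x ∈ Finset.range a, bregG (a + b + x) := by
    refine Finset.sum_congr rfl fun x hx => ?_
    rw [Finset.mem_range] at hx
    congr 1; omega
  have e2 : ∑ x ∈ Finset.range b, bregG (min (a + b + a) (a + x + r + 1) - (a + x - r)) =
      b * bregG n := by
    rw [Finset.sum_congr rfl (g := fun _ => bregG n)]
    · simp
    · intro x hx
      rw [Finset.mem_range] at hx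
      congr 1; omega
  have e3 : ∑ x ∈ Finset.range a, bregG (min (a + b + a) (a + b + x + r + 1) - (a + b + x - r)) =
      ∑ x ∈ Finset.range a, bregG (a + b + x) := by
    rw [← Finset.sum_range_reflect (fun x => bregG (a + b + x))]
    refine Finset.sum_congr rfl fun x hx => ?_
    rw [Finset.mem_range] at hx
    congr 1; omega
  rw [e1, e2, e3]
  have : a + b + a - (a + b) = a := by omega
  rw [this]
  ring

/-- For `(n-1)/2 ≤ r ≤ n-1` (i.e. `n ≤ 2r + 1` and `r < n`),
`|B_{r,n}| ≤ (n!)^((2r+2-n)/n) ⬝ ∏_{i=r+1}^{n-1} (i!)^(2/i)`,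
with real exponents. -/
theorem ball_upper_bound_large_radius (n r : ℕ) (hn : 1 ≤ n)
    (hr1 : n ≤ 2 * r + 1) (hr2 : r < n) :
    (ballCard n r : ℝ) ≤
      ((Nat.factorial n : ℝ) ^ ((2 * (r : ℝ) + 2 - n) / n)) *
        ∏ i ∈ Finset.Icc (r + 1) (n - 1),
          (Nat.factorial i : ℝ) ^ ((2 : ℝ) / i) := by
  have hcard : ballCard n r = (permSupp (band n r)).card := by
    unfold ballCard
    rw [← Nat.card_eq_finsetCard]
    refine Nat.card_congr (Equiv.subtypeEquivRight fun g => ?_)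
    simp [permSupp, band, dinf]
  have hne : (permSupp (band n r)).Nonempty := ⟨1, by simp [permSupp, band]⟩
  have h := bregman_aux n Finset.univ (band n r) (by simp) (by simp) hne
  rw [band_sum n r hr1 hr2] at h
  have hpos : (0 : ℝ) < (permSupp (band n r)).card := by exact_mod_cast hne.card_pos
  rw [hcard, ← Real.exp_log hpos]
  refine (Real.exp_le_exp.2 h).trans (le_of_eq ?_)
  rw [Real.exp_add, Real.exp_sum]
  congr 1
  · rw [Real.rpow_def_of_pos (by positivity)]
    congr 1
    unfold bregG; ring
  · refine Finset.prod_congr rfl fun i _ => ?_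
    rw [Real.rpow_def_of_pos (by positivity)]
    congr 1
    unfold bregG; ring
end
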